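/- arXiv:1409.4242 — 2 statements merged into one kernel-verified Lean document; each statement's English description precedes it below -/
import Mathlib

section
/- Fix Q_0 ∈ Δ. There exist constants c, C' > 0 depending only on n and the constants of the dyadic cube system such that for every δ > 0 and ε ∈ (0, 1/2), writing Σ(cδ^n) = ⋃_{Q ∈ SI(cδ^n, Q_0)} Q, one has μ(Σ(cδ^n)) ≤ C' μ(Q_0 ∖ DC(δ, ε, 16·ℓ(Q_0))). -/
open MeasureTheory Metric Set Filter ENNReal NNReal Topology

noncomputable section

/-- A system of "dyadic cubes" adapted to a compact set `K` of a metric measure space, as in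
Christ's construction: `cubes k` is the (countable) family of cubes of generation `k ≤ kK`. -/
structure CubeSystem (X : Type) [MetricSpace X] [MeasurableSpace X]
    (μ : Measure X) (K : Set X) (n : ℕ) (C RK a η₀ : ℝ) : Type where
  kK : ℤ
  size : (16 : ℝ) ^ (kK + 2) ≤ RK
  cubes : ℤ → Set (Set X)
  countable : ∀ k : ℤ, (cubes k).Countable
  cover : ∀ k : ℤ, k ≤ kK → μ (K \ ⋃₀ cubes k) = 0
  nested : ∀ k j : ℤ, k ≤ j → j ≤ kK →
    ∀ Q ∈ cubes k, ∀ Q' ∈ cubes j, Q ⊆ Q' ∨ Q ∩ Q' = ∅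
  ancestor : ∀ j : ℤ, j ≤ kK → ∀ Q ∈ cubes j, ∀ k : ℤ, j ≤ k → k ≤ kK →
    ∃! Q', Q' ∈ cubes k ∧ Q ⊆ Q'
  ball : ∀ k : ℤ, k ≤ kK → ∀ Q ∈ cubes k, ∃ z ∈ K,
    closedBall z ((16 : ℝ) ^ (k - 1)) ⊆ Q ∧ Q ⊆ closedBall z ((16 : ℝ) ^ (k + 1))
  smallBoundary : ∀ k : ℤ, k ≤ kK → ∀ Q ∈ cubes k, ∀ t : ℝ, 0 < t →
    μ {x | x ∈ Q ∩ K ∧ infDist x Qᶜ ≤ t * (16 : ℝ) ^ k} ≤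
      ENNReal.ofReal (a * t ^ η₀) * μ Q
  growth : ∀ k : ℤ, k ≤ kK → ∀ Q ∈ cubes k,
    ENNReal.ofReal (C⁻¹ * (16 : ℝ) ^ ((k - 1) * (n : ℤ))) ≤ μ Q ∧
      μ Q ≤ ENNReal.ofReal (C * (16 : ℝ) ^ ((k + 1) * (n : ℤ)))

variable {X : Type} [MetricSpace X] [MeasurableSpace X]
  {μ : Measure X} {K : Set X} {n : ℕ} {C RK a η₀ : ℝ}

/-- Membership in the cube system `Δ`. -/
def IsCube (D : CubeSystem X μ K n C RK a η₀) (Q : Set X) : Prop :=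
  ∃ k : ℤ, k ≤ D.kK ∧ Q ∈ D.cubes k

/-- `j(Q)`: the largest generation to which a cube belongs. -/
def lvl (D : CubeSystem X μ K n C RK a η₀) (Q : Set X) : ℤ :=
  sSup {k : ℤ | k ≤ D.kK ∧ Q ∈ D.cubes k}

/-- `ℓ(Q) = 16 ^ j(Q)`. -/
def sidelength (D : CubeSystem X μ K n C RK a η₀) (Q : Set X) : ℝ :=
  (16 : ℝ) ^ lvl D Q

/-- The distance between two sets. -/
def setDist (s t : Set X) : ℝ :=
  sInf (Set.image2 dist s t)

/-- The dilate `λQ = {x : dist(x, Q) ≤ (λ - 1) diam Q}`. -/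
def dilate (Q : Set X) (l : ℝ) : Set X :=
  {x | infDist x Q ≤ (l - 1) * Metric.diam Q}

/-- Two cubes are `A`-neighbours. -/
def ANeighbor (A : ℝ) (Q Q' : Set X) : Prop :=
  setDist Q Q' ≤ A * (Metric.diam Q + Metric.diam Q') ∧
  A⁻¹ * Metric.diam Q ≤ Metric.diam Q' ∧ Metric.diam Q' ≤ A * Metric.diam Q

/-- `Q̂`: the union of the cubes of generation `j(Q)` within `diam Q` of `Q`, intersected
with `Q₀`. -/
def hat (D : CubeSystem X μ K n C RK a η₀) (Q₀ Q : Set X) : Set X :=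
  (⋃₀ {S | S ∈ D.cubes (lvl D Q) ∧ setDist S Q ≤ Metric.diam Q}) ∩ Q₀

/-- The set `DC(β, ε, R)`, relative to `K` and the chart `φ`. -/
def DCset (K : Set X) (φ : X → EuclideanSpace ℝ (Fin n)) (β ε R : ℝ) : Set X :=
  {x | x ∈ K ∧ ∀ r : ℝ, 0 < r → r < R →
    ENNReal.ofReal (1 - ε) * μH[n] (closedBall (φ x) (β * r)) ≤
      μH[n] (closedBall (φ x) (β * r) ∩ φ '' (closedBall x r ∩ K))}

/-- The family `SI(δ, Q₀)` of cubes contained in a cube of small image. -/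
def SIset (D : CubeSystem X μ K n C RK a η₀) (φ : X → EuclideanSpace ℝ (Fin n))
    (δ : ℝ) (Q₀ : Set X) : Set (Set X) :=
  {Q | IsCube D Q ∧ Q ⊆ Q₀ ∧ ∃ W, IsCube D W ∧ W ⊆ Q₀ ∧ Q ⊆ W ∧
    μH[n] (φ '' (W ∩ K)) < ENNReal.ofReal δ * μ W}

/-- The family `LD(η, Q₀)` of cubes contained in a cube of low density. -/
def LDset (D : CubeSystem X μ K n C RK a η₀) (η : ℝ) (Q₀ : Set X) : Set (Set X) :=
  {Q | IsCube D Q ∧ Q ⊆ Q₀ ∧ ∃ W, IsCube D W ∧ W ⊆ Q₀ ∧ Q ⊆ W ∧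
    μ (W ∩ K) < ENNReal.ofReal η * μ W}

/-- The family `M_A(ζ, Q₀)` of cubes whose image measure ratio is nearly preserved by all
`A`-neighbours. -/
def MAset (D : CubeSystem X μ K n C RK a η₀) (φ : X → EuclideanSpace ℝ (Fin n))
    (δ ζ A : ℝ) (Q₀ : Set X) : Set (Set X) :=
  {Q | IsCube D Q ∧ Q ⊆ Q₀ ∧
    ENNReal.ofReal ((1 + ζ)⁻¹ * δ) * μ Q ≤ μH[n] (φ '' (Q ∩ K)) ∧
    (∀ R, IsCube D R → ANeighbor A Q R →
      R ⊆ Q₀ ∧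
      (ENNReal.ofReal (1 + ζ))⁻¹ * (μH[n] (φ '' (Q ∩ K)) / μ Q) ≤
          μH[n] (φ '' (R ∩ K)) / μ R ∧
      μH[n] (φ '' (R ∩ K)) / μ R ≤
          ENNReal.ofReal (1 + ζ) * (μH[n] (φ '' (Q ∩ K)) / μ Q)) ∧
    (∀ R, IsCube D R → ANeighbor A Q R →
      (ENNReal.ofReal (1 + ζ))⁻¹ * (μH[n] (φ '' (Q ∩ K)) / μ Q) ≤
          μH[n] (φ '' (hat D Q₀ R ∩ K)) / μ (hat D Q₀ R) ∧
      μH[n] (φ '' (hat D Q₀ R ∩ K)) / μ (hat D Q₀ R) ≤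
          ENNReal.ofReal (1 + ζ) * (μH[n] (φ '' (Q ∩ K)) / μ Q))}

/-- A family of cubes is a `K`-Carleson set with constant `C'`. -/
def KCarleson (D : CubeSystem X μ K n C RK a η₀) (E : Set (Set X)) (C' : ℝ) : Prop :=
  ∀ Q₀ : Set X, IsCube D Q₀ →
    (∑' Q : ↥{Q | Q ∈ E ∧ Q ⊆ Q₀}, μ ((Q : Set X) ∩ K)) ≤ ENNReal.ofReal C' * μ Q₀

/-- A stopping time region with top cube `top`. -/
def IsSTRegion (D : CubeSystem X μ K n C RK a η₀) (S : Set (Set X)) (top : Set X) : Prop :=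
  top ∈ S ∧ (∀ Q ∈ S, IsCube D Q) ∧ (∀ Q ∈ S, Q ⊆ top) ∧
    ∀ Q ∈ S, ∀ Q', IsCube D Q' → Q ⊆ Q' → Q' ⊆ top → Q' ∈ S

/-- `Q'` is a child of `Q`: a maximal cube of `Δ` properly contained in `Q`. -/
def IsChild (D : CubeSystem X μ K n C RK a η₀) (Q' Q : Set X) : Prop :=
  IsCube D Q' ∧ Q' ⊂ Q ∧ ∀ Q'', IsCube D Q'' → Q'' ⊂ Q → Q' ⊆ Q'' → Q'' = Q'

theorem hausdorffMeasure_closedBall_euclidean (n : ℕ) (y : EuclideanSpace ℝ (Fin n)) {r : ℝ}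
    (hr : 0 ≤ r) :
    μH[n] (closedBall y r) =
      ENNReal.ofReal (r ^ n) * μH[n] (ball (0 : EuclideanSpace ℝ (Fin n)) 1) := by
  have h := isAddHaarMeasure_hausdorffMeasure (E := EuclideanSpace ℝ (Fin n))
  rw [finrank_euclideanSpace_fin] at h
  have := Measure.addHaar_closedBall (μH[n] : Measure (EuclideanSpace ℝ (Fin n))) y hr
  rwa [finrank_euclideanSpace_fin] at this

theorem hausdorffMeasure_unitBall_euclidean_pos (n : ℕ) :
    0 < μH[n] (ball (0 : EuclideanSpace ℝ (Fin n)) 1) := by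
  have h := isAddHaarMeasure_hausdorffMeasure (E := EuclideanSpace ℝ (Fin n))
  rw [finrank_euclideanSpace_fin] at h
  exact measure_ball_pos _ _ one_pos

theorem hausdorffMeasure_unitBall_euclidean_lt_top (n : ℕ) :
    μH[n] (ball (0 : EuclideanSpace ℝ (Fin n)) 1) < ∞ := by
  have h := isAddHaarMeasure_hausdorffMeasure (E := EuclideanSpace ℝ (Fin n))
  rw [finrank_euclideanSpace_fin] at h
  exact measure_ball_lt_top

theorem CubeSystem.nonempty_of_mem (D : CubeSystem X μ K n C RK a η₀) {k : ℤ} (hk : k ≤ D.kK)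
    {Q : Set X} (hQ : Q ∈ D.cubes k) : Q.Nonempty := by
  obtain ⟨z, -, hz, -⟩ := D.ball k hk Q hQ
  exact ⟨z, hz (mem_closedBall_self (by positivity))⟩

theorem CubeSystem.subset_of_level_le (D : CubeSystem X μ K n C RK a η₀) {k j : ℤ} (hkj : k ≤ j)
    (hj : j ≤ D.kK) {Q Q' : Set X} (hQ : Q ∈ D.cubes k) (hQ' : Q' ∈ D.cubes j)
    (hne : (Q ∩ Q').Nonempty) : Q ⊆ Q' :=
  (D.nested k j hkj hj Q hQ Q' hQ').resolve_right hne.ne_empty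

theorem bddAbove_levels (D : CubeSystem X μ K n C RK a η₀) (Q : Set X) :
    BddAbove {k : ℤ | k ≤ D.kK ∧ Q ∈ D.cubes k} :=
  ⟨D.kK, fun _ h => h.1⟩

theorem lvl_spec (D : CubeSystem X μ K n C RK a η₀) {Q : Set X} (hQ : IsCube D Q) :
    lvl D Q ≤ D.kK ∧ Q ∈ D.cubes (lvl D Q) :=
  Int.csSup_mem hQ (bddAbove_levels D Q)

theorem level_le_lvl_of_subset (D : CubeSystem X μ K n C RK a η₀) {k : ℤ} (hk : k ≤ D.kK)
    {W Q : Set X} (hW : W ∈ D.cubes k) (hQ : IsCube D Q) (hWQ : W ⊆ Q) : k ≤ lvl D Q := by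
  by_contra! hlt
  have hne : (Q ∩ W).Nonempty := by
    rw [inter_eq_self_of_subset_right hWQ]
    exact D.nonempty_of_mem hk hW
  have hQW := D.subset_of_level_le hlt.le hk (lvl_spec D hQ).2 hW hne
  have hEq : W = Q := hWQ.antisymm hQW
  exact hlt.not_ge (le_csSup (bddAbove_levels D Q) ⟨hk, hEq ▸ hW⟩)

theorem countable_isCube (D : CubeSystem X μ K n C RK a η₀) : {Q | IsCube D Q}.Countable := by
  refine (countable_iUnion D.countable).mono ?_
  rintro Q ⟨k, -, hk⟩
  exact mem_iUnion.2 ⟨k, hk⟩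

/-- A family of cubes has a pairwise disjoint subfamily with the same union: its maximal cubes. -/
theorem exists_disjoint_subfamily (D : CubeSystem X μ K n C RK a η₀) (F : Set (Set X))
    (hF : ∀ Q ∈ F, IsCube D Q) :
    ∃ G ⊆ F, G.PairwiseDisjoint id ∧ ∀ Q ∈ F, ∃ W ∈ G, Q ⊆ W := by
  refine ⟨{W | W ∈ F ∧ ∀ W' ∈ F, W ⊆ W' → W' = W}, fun W h => h.1, ?_, ?_⟩
  · intro W hW V hV hne
    by_contra hd
    rw [Function.onFun, id, id, not_disjoint_iff_nonempty_inter] at hd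
    obtain ⟨k, hk, hWk⟩ := hF W hW.1
    obtain ⟨j, hj, hVj⟩ := hF V hV.1
    rcases le_total k j with h | h
    · exact hne (hW.2 V hV.1 (D.subset_of_level_le h hj hWk hVj hd)).symm
    · exact hne (hV.2 W hW.1 (D.subset_of_level_le h hk hVj hWk (inter_comm W V ▸ hd)))
  · intro Q hQ
    set S : Set ℤ := {k | k ≤ D.kK ∧ ∃ W ∈ F, W ∈ D.cubes k ∧ Q ⊆ W} with hS
    have hSb : BddAbove S := ⟨D.kK, fun _ h => h.1⟩
    obtain ⟨k₀, hk₀, hQk₀⟩ := hF Q hQ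
    obtain ⟨hk, W, hWF, hWk, hQW⟩ : sSup S ∈ S :=
      Int.csSup_mem ⟨k₀, hk₀, Q, hQ, hQk₀, Subset.rfl⟩ hSb
    refine ⟨W, ⟨hWF, fun V hV hWV => ?_⟩, hQW⟩
    obtain ⟨j, hj, hVj⟩ := hF V hV
    have hjk : j ≤ sSup S := le_csSup hSb ⟨hj, V, hV, hVj, hQW.trans hWV⟩
    refine (D.subset_of_level_le hjk hk hVj hWk ?_).antisymm hWV
    rw [inter_eq_self_of_subset_right hWV]
    exact D.nonempty_of_mem hk hWk

/-- A cube with small image contains a ball of comparable measure that misses `DC`. -/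
theorem exists_ball_subset_diff_DCset (hC : 1 < C)
    (hreg : ∀ x ∈ K, ∀ r : ℝ, 0 < r → r < RK →
      ENNReal.ofReal (C⁻¹ * r ^ n) ≤ μ (closedBall x r) ∧
        μ (closedBall x r) ≤ ENNReal.ofReal (C * r ^ n))
    (D : CubeSystem X μ K n C RK a η₀) (φ : X → EuclideanSpace ℝ (Fin n))
    {Q₀ : Set X} (hQ₀ : IsCube D Q₀) {δ ε c : ℝ} (hδ : 0 < δ) (hε : ε < 1 / 2) (hc₀ : 0 < c)
    (hc : c * (C * 512 ^ n) ≤ (μH[n] (ball (0 : EuclideanSpace ℝ (Fin n)) 1)).toReal / 2)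
    {W : Set X} (hW : IsCube D W) (hWQ₀ : W ⊆ Q₀)
    (hsmall : μH[n] (φ '' (W ∩ K)) < ENNReal.ofReal (c * δ ^ n) * μ W) :
    ∃ z : X, ∃ r : ℝ, closedBall z r ⊆ W ∧
      closedBall z r ⊆ Q₀ \ DCset K φ δ ε (16 * (16 : ℝ) ^ lvl D Q₀) ∧
      μ W ≤ ENNReal.ofReal (C ^ 2 * 512 ^ n) * μ (closedBall z r) := by
  obtain ⟨k, hk, hWk⟩ := hW
  obtain ⟨z, hzK, hzW, -⟩ := D.ball k hk W hWk
  set r : ℝ := (16 : ℝ) ^ (k - 1) / 2 with hr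
  have hr₀ : 0 < r := by positivity
  have h16 : (16 : ℝ) ^ (k - 1) = 2 * r := by rw [hr]; ring
  rw [h16] at hzW
  have hpow : (16 : ℝ) ^ ((k + 1) * (n : ℤ)) = 512 ^ n * r ^ n := by
    rw [zpow_mul, zpow_natCast, ← mul_pow, show k + 1 = (k - 1) + 2 by ring,
      zpow_add₀ (by norm_num), h16]
    congr 1
    norm_num
    ring
  have hzpow_le : ∀ j : ℤ, k - 1 ≤ j → r < (16 : ℝ) ^ j := fun j hj => by
    have := zpow_le_zpow_right₀ (a := (16 : ℝ)) (by norm_num) hj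
    linarith
  have hrRK : r < RK := (hzpow_le _ (by linarith)).trans_le D.size
  have hrQ₀ : r < 16 * (16 : ℝ) ^ lvl D Q₀ := by
    have := hzpow_le _ (sub_one_lt k |>.le.trans (level_le_lvl_of_subset D hk hWk hQ₀ hWQ₀))
    linarith
  have hμW : μ W ≤ ENNReal.ofReal (C * (512 ^ n * r ^ n)) := by
    rw [← hpow]
    exact (D.growth k hk W hWk).2
  have hsub : closedBall z r ⊆ W := (closedBall_subset_closedBall (by linarith)).trans hzW
  refine ⟨z, r, hsub, fun x hx => ⟨hWQ₀ (hsub hx), fun hxDC => ?_⟩, ?_⟩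
  · have hball : closedBall x r ⊆ W := by
      refine (closedBall_subset_closedBall' ?_).trans hzW
      have := mem_closedBall.1 hx
      linarith
    set v := μH[n] (ball (0 : EuclideanSpace ℝ (Fin n)) 1) with hv
    have hv_top : v ≠ ∞ := (hausdorffMeasure_unitBall_euclidean_lt_top n).ne
    have hlow : ENNReal.ofReal (1 / 2 * ((δ * r) ^ n * v.toReal)) ≤ μH[n] (φ '' (W ∩ K)) :=
      calc ENNReal.ofReal (1 / 2 * ((δ * r) ^ n * v.toReal))
          = ENNReal.ofReal (1 / 2) * μH[n] (closedBall (φ x) (δ * r)) := by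
            rw [hausdorffMeasure_closedBall_euclidean n _ (by positivity),
              ENNReal.ofReal_mul (by norm_num), ENNReal.ofReal_mul (by positivity),
              ENNReal.ofReal_toReal hv_top]
        _ ≤ ENNReal.ofReal (1 - ε) * μH[n] (closedBall (φ x) (δ * r)) := by
            gcongr
            linarith
        _ ≤ μH[n] (closedBall (φ x) (δ * r) ∩ φ '' (closedBall x r ∩ K)) := hxDC.2 r hr₀ hrQ₀
        _ ≤ μH[n] (φ '' (W ∩ K)) :=
            measure_mono (inter_subset_right.trans
              (image_mono (inter_subset_inter_left K hball)))
    have hup : ENNReal.ofReal (c * δ ^ n) * μ W ≤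
        ENNReal.ofReal (1 / 2 * ((δ * r) ^ n * v.toReal)) := by
      refine (mul_le_mul_right hμW _).trans ?_
      rw [← ENNReal.ofReal_mul (by positivity)]
      refine ENNReal.ofReal_le_ofReal ?_
      calc c * δ ^ n * (C * (512 ^ n * r ^ n)) = (c * (C * 512 ^ n)) * (δ * r) ^ n := by
            rw [mul_pow]; ring
        _ ≤ v.toReal / 2 * (δ * r) ^ n := by gcongr
        _ = 1 / 2 * ((δ * r) ^ n * v.toReal) := by ring
    exact (hsmall.trans_le (hup.trans hlow)).false
  · refine hμW.trans (le_trans (le_of_eq ?_) (mul_le_mul_right (hreg z hzK r hr₀ hrRK).1 _))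
    rw [← ENNReal.ofReal_mul (by positivity)]
    congr 1
    field_simp

theorem SI_measure_bound (n : ℕ) (C a η₀ : ℝ) (hC : 1 < C) (ha : 0 < a) (hη₀ : 0 < η₀) :
    ∃ c : ℝ, 0 < c ∧ ∃ C' : ℝ, 0 < C' ∧
      ∀ (X : Type) [MetricSpace X] [CompleteSpace X] [TopologicalSpace.SeparableSpace X]
        [MeasurableSpace X] [BorelSpace X],
      ∀ (μ : Measure X) [IsFiniteMeasure μ],
      ∀ (K : Set X) (RK : ℝ), IsCompact K → 0 < RK →
      (∀ x ∈ K, ∀ r : ℝ, 0 < r → r < RK →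
        ENNReal.ofReal (C⁻¹ * r ^ n) ≤ μ (closedBall x r) ∧
          μ (closedBall x r) ≤ ENNReal.ofReal (C * r ^ n)) →
      ∀ (D : CubeSystem X μ K n C RK a η₀) (φ : X → EuclideanSpace ℝ (Fin n)),
        LipschitzWith 1 φ →
      ∀ Q₀ : Set X, IsCube D Q₀ →
      ∀ δ : ℝ, 0 < δ → ∀ ε : ℝ, 0 < ε → ε < 1 / 2 →
        μ (⋃₀ SIset D φ (c * δ ^ n) Q₀) ≤
          ENNReal.ofReal C' *
            μ (Q₀ \ DCset K φ δ ε (16 * (16 : ℝ) ^ lvl D Q₀)) := by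
  set v := μH[n] (ball (0 : EuclideanSpace ℝ (Fin n)) 1) with hv
  have hv₀ : 0 < v.toReal := ENNReal.toReal_pos (hausdorffMeasure_unitBall_euclidean_pos n).ne'
    (hausdorffMeasure_unitBall_euclidean_lt_top n).ne
  have hC₀ : 0 < C := by linarith
  have hc₀ : 0 < v.toReal / 2 / (C * 512 ^ n) := by positivity
  refine ⟨v.toReal / 2 / (C * 512 ^ n), hc₀, C ^ 2 * 512 ^ n, by positivity, ?_⟩
  intro X _ _ _ _ _ μ _ K RK hK hRK hreg D φ hφ Q₀ hQ₀ δ hδ ε hε₀ hε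
  set c := v.toReal / 2 / (C * 512 ^ n) with hc
  obtain ⟨G, hGF, hGd, hGc⟩ := exists_disjoint_subfamily D
    {W | IsCube D W ∧ W ⊆ Q₀ ∧ μH[n] (φ '' (W ∩ K)) < ENNReal.ofReal (c * δ ^ n) * μ W}
    (fun W hW => hW.1)
  have hball : ∀ W : Set X, ∃ z : X, ∃ r : ℝ, W ∈ G → closedBall z r ⊆ W ∧
      closedBall z r ⊆ Q₀ \ DCset K φ δ ε (16 * (16 : ℝ) ^ lvl D Q₀) ∧
      μ W ≤ ENNReal.ofReal (C ^ 2 * 512 ^ n) * μ (closedBall z r) := by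
    intro W
    by_cases hW : W ∈ G
    · obtain ⟨hcube, hsub, hsmall⟩ := hGF hW
      obtain ⟨z, r, h⟩ := exists_ball_subset_diff_DCset hC hreg D φ hQ₀ hδ hε hc₀
        (div_mul_cancel₀ _ (by positivity)).le hcube hsub hsmall
      exact ⟨z, r, fun _ => h⟩
    · obtain ⟨k, hk, hQk⟩ := hQ₀
      obtain ⟨z, -⟩ := D.nonempty_of_mem hk hQk
      exact ⟨z, 0, fun h => (hW h).elim⟩
  choose z r hzr using hball
  have hG : G.Countable := (countable_isCube D).mono fun W hW => (hGF hW).1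
  have := hG.to_subtype
  have hdisj : Pairwise (Function.onFun Disjoint fun W : G => closedBall (z W) (r W)) :=
    fun V W hne => (hGd V.2 W.2 (Subtype.coe_injective.ne hne)).mono
      (hzr V V.2).1 (hzr W W.2).1
  calc μ (⋃₀ SIset D φ (c * δ ^ n) Q₀)
      ≤ μ (⋃ W : G, (W : Set X)) := by
        refine measure_mono (sUnion_subset ?_)
        rintro Q ⟨-, -, W, hW, hWQ₀, hQW, hsmall⟩
        obtain ⟨V, hV, hWV⟩ := hGc W ⟨hW, hWQ₀, hsmall⟩
        exact (hQW.trans hWV).trans (subset_iUnion (fun W : G => (W : Set X)) ⟨V, hV⟩)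
    _ ≤ ∑' W : G, μ W := measure_iUnion_le _
    _ ≤ ∑' W : G, ENNReal.ofReal (C ^ 2 * 512 ^ n) * μ (closedBall (z W) (r W)) :=
        ENNReal.tsum_le_tsum fun W => (hzr W W.2).2.2
    _ = ENNReal.ofReal (C ^ 2 * 512 ^ n) * μ (⋃ W : G, closedBall (z W) (r W)) := by
        rw [ENNReal.tsum_mul_left, measure_iUnion hdisj fun W => isClosed_closedBall.measurableSet]
    _ ≤ ENNReal.ofReal (C ^ 2 * 512 ^ n) *
          μ (Q₀ \ DCset K φ δ ε (16 * (16 : ℝ) ^ lvl D Q₀)) := by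
        gcongr
        exact iUnion_subset fun W => (hzr W W.2).2.1

end
end

section
/- Fix Q_0 ∈ Δ and let η, δ > 0 and A > 1. Then there exists ζ_0 > 0 such that for each ζ < ζ_0 there exists C'' > 0, depending only on η, δ, A, ζ and the constants of K and the cube system, such that Σ_{Q ∈ Δ(Q_0) ∖ (M_A(ζ, Q_0) ∪ SI(δ, Q_0) ∪ LD(η, Q_0))} μ(Q ∩ K) ≤ C'' μ(Q_0). -/
open MeasureTheory Metric Set Filter ENNReal NNReal Topology

noncomputable section

variable {X : Type} [MetricSpace X] [MeasurableSpace X]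
  {μ : Measure X} {K : Set X} {n : ℕ} {C RK a η₀ : ℝ}

set_option linter.unusedSectionVars false

/-- The points of `Y` whose distance to the complement of `Y` is at least `ρ`. -/
def innerCore (ρ : ℝ) (Y : Set X) : Set X := (thickening ρ Yᶜ)ᶜ

lemma measurableSet_innerCore [BorelSpace X] (ρ : ℝ) (Y : Set X) :
    MeasurableSet (innerCore ρ Y) :=
  isOpen_thickening.measurableSet.compl

lemma innerCore_subset {ρ : ℝ} (hρ : 0 < ρ) (Y : Set X) : innerCore ρ Y ⊆ Y := by
  intro x hx
  by_contra h
  exact hx (self_subset_thickening hρ _ h)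

lemma subset_of_mem_innerCore {ρ : ℝ} {Y B : Set X} {x : X} (hx : x ∈ innerCore ρ Y)
    (hxB : x ∈ B) (hB : ∀ p ∈ B, ∀ q ∈ B, dist p q < ρ) : B ⊆ Y := by
  intro y hy
  by_contra h
  exact hx (mem_thickening_iff.2 ⟨y, h, hB x hxB y hy⟩)

/-- A monotone, subadditive set function dominated by `M * μ`. -/
structure IsContent (μ : Measure X) (h : Set X → ℝ) (M : ℝ) : Prop where
  M_nonneg : 0 ≤ M
  nonneg : ∀ A, 0 ≤ h A
  mono : ∀ A B, A ⊆ B → h A ≤ h B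
  union_le : ∀ A B, h (A ∪ B) ≤ h A + h B
  le_mul : ∀ A, h A ≤ M * μ.real A

/-- The gap between `M² μ(B)` and the energy `h(B)² / μ(B)` of a block `B`. -/
def defect (μ : Measure X) (h : Set X → ℝ) (M : ℝ) (B : Set X) : ℝ :=
  M ^ 2 * μ.real B - h B ^ 2 / μ.real B

section Energy

variable {h : Set X → ℝ} {M : ℝ}

lemma IsContent.defect_nonneg (hh : IsContent μ h M) (B : Set X) : 0 ≤ defect μ h M B := by
  have h1 := hh.le_mul B
  have h2 := hh.nonneg B
  have h3 : (0 : ℝ) ≤ μ.real B := measureReal_nonneg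
  unfold defect
  rcases h3.eq_or_lt with h4 | h4
  · simp [← h4]
  · rw [sub_nonneg, div_le_iff₀ h4]
    nlinarith

lemma defect_le (μ : Measure X) (h : Set X → ℝ) (M : ℝ) (B : Set X) :
    defect μ h M B ≤ M ^ 2 * μ.real B := by
  have : 0 ≤ h B ^ 2 / μ.real B := div_nonneg (sq_nonneg _) measureReal_nonneg
  unfold defect
  linarith

lemma sq_div_add_gain_le {a b p q v M : ℝ} (ha : 0 ≤ a) (hb : 0 ≤ b) (hp : 0 ≤ p) (hq : 0 ≤ q)
    (hv : 0 ≤ v) (hvpq : v ≤ p + q) (hpa : p ≤ M * a) (hqb : q ≤ M * b) :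
    v ^ 2 / (a + b) + a * (p / a - v / (a + b)) ^ 2 ≤ p ^ 2 / a + q ^ 2 / b := by
  rcases ha.eq_or_lt with rfl | ha
  · have : p = 0 := by nlinarith
    subst this
    rcases hb.eq_or_lt with rfl | hb
    · simp
    · have h1 : v ^ 2 ≤ q ^ 2 := by gcongr; linarith
      simpa using div_le_div_of_nonneg_right h1 hb.le
  rcases hb.eq_or_lt with rfl | hb
  · have : q = 0 := by nlinarith
    subst this
    set x := p / a with hx
    have hp' : p = a * x := by rw [hx]; field_simp
    set y := v / a with hy
    have hv' : v = a * y := by rw [hy]; field_simp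
    have hy0 : 0 ≤ y := by positivity
    have hyx : y ≤ x := by rw [hx, hy]; gcongr; linarith
    have e1 : v ^ 2 / (a + 0) = a * y ^ 2 := by rw [hv']; field_simp; ring
    have e2 : p ^ 2 / a = a * x ^ 2 := by rw [hp']; field_simp
    rw [e1, e2, add_zero, ← hy]
    simp only [ne_eq, OfNat.ofNat_ne_zero, not_false_eq_true, zero_pow, zero_div, add_zero]
    nlinarith [mul_nonneg ha.le (mul_nonneg hy0 (sub_nonneg.2 hyx))]
  set x := p / a with hx
  have hp' : p = a * x := by rw [hx]; field_simp
  set z := q / b with hz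
  have hq' : q = b * z := by rw [hz]; field_simp
  set y := v / (a + b) with hy
  have hv' : v = (a + b) * y := by rw [hy]; field_simp
  have hy0 : 0 ≤ y := by positivity
  have e1 : v ^ 2 / (a + b) = (a + b) * y ^ 2 := by rw [hv']; field_simp
  have e2 : p ^ 2 / a = a * x ^ 2 := by rw [hp']; field_simp
  have e3 : q ^ 2 / b = b * z ^ 2 := by rw [hq']; field_simp
  rw [e1, e2, e3]
  have h1 : (a + b) * y ≤ a * x + b * z := by rw [← hv', ← hp', ← hq']; exact hvpq
  nlinarith [mul_nonneg hy0 (sub_nonneg.2 h1), mul_nonneg hb.le (sq_nonneg (z - y))]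

/-- Merging two blocks increases the total defect by a quadratic amount. -/
lemma IsContent.defect_union (hh : IsContent μ h M) [IsFiniteMeasure μ] {A B : Set X}
    (hAB : Disjoint A B) (hB : MeasurableSet B) :
    defect μ h M A + defect μ h M B +
        μ.real A * (h A / μ.real A - h (A ∪ B) / μ.real (A ∪ B)) ^ 2 ≤
      defect μ h M (A ∪ B) := by
  have hm : μ.real (A ∪ B) = μ.real A + μ.real B := measureReal_union hAB hB
  have := sq_div_add_gain_le (a := μ.real A) (b := μ.real B) measureReal_nonneg measureReal_nonneg
    (hh.nonneg A) (hh.nonneg B) (hh.nonneg (A ∪ B)) (hh.union_le A B) (hh.le_mul A) (hh.le_mul B)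
  unfold defect
  rw [hm]
  linarith

lemma IsContent.defect_add_le (hh : IsContent μ h M) [IsFiniteMeasure μ] {A B : Set X}
    (hAB : Disjoint A B) (hB : MeasurableSet B) :
    defect μ h M A + defect μ h M B ≤ defect μ h M (A ∪ B) := by
  have h1 := hh.defect_union hAB hB
  have : 0 ≤ μ.real A * (h A / μ.real A - h (A ∪ B) / μ.real (A ∪ B)) ^ 2 :=
    mul_nonneg measureReal_nonneg (sq_nonneg _)
  linarith

lemma IsContent.defect_mono (hh : IsContent μ h M) [IsFiniteMeasure μ] {A B : Set X}
    (hA : MeasurableSet A) (hB : MeasurableSet B) (hAB : A ⊆ B) :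
    defect μ h M A ≤ defect μ h M B := by
  have h1 := hh.defect_add_le (A := A) (B := B \ A) disjoint_sdiff_right (hB.diff hA)
  rw [union_sdiff_cancel hAB] at h1
  linarith [hh.defect_nonneg (B \ A)]

lemma IsContent.sum_defect_le (hh : IsContent μ h M) [IsFiniteMeasure μ]
    (𝓑 : Finset (Set X)) (hmeas : ∀ B ∈ 𝓑, MeasurableSet B)
    (hdisj : (𝓑 : Set (Set X)).PairwiseDisjoint id) {Y : Set X} (hY : MeasurableSet Y)
    (hsub : ∀ B ∈ 𝓑, B ⊆ Y) : ∑ B ∈ 𝓑, defect μ h M B ≤ defect μ h M Y := by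
  classical
  have key : ∑ B ∈ 𝓑, defect μ h M B ≤ defect μ h M (⋃₀ (𝓑 : Set (Set X))) := by
    induction 𝓑 using Finset.induction_on with
    | empty => simp [defect]
    | insert B 𝓑 hB ih =>
      rw [Finset.sum_insert hB, Finset.coe_insert, sUnion_insert]
      have h1 := ih (fun B hB => hmeas B (Finset.mem_insert_of_mem hB))
        (hdisj.subset (by simp)) (fun B hB => hsub B (Finset.mem_insert_of_mem hB))
      have h2 : Disjoint B (⋃₀ (𝓑 : Set (Set X))) := by
        rw [disjoint_sUnion_right]
        intro B' hB'
        exact hdisj (by simp) (by simp [Finset.mem_coe.1 hB']) (by rintro rfl; exact hB hB')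
      have h3 : MeasurableSet (⋃₀ (𝓑 : Set (Set X))) :=
        MeasurableSet.sUnion 𝓑.countable_toSet
          fun B hB => hmeas B (Finset.mem_insert_of_mem hB)
      linarith [hh.defect_add_le h2 h3]
  refine key.trans (hh.defect_mono ?_ hY (sUnion_subset hsub))
  exact MeasurableSet.sUnion 𝓑.countable_toSet hmeas

/-- Multiscale packing: given regions `V i` at separated scales, each of which has a subset `Y i`
of definitely different density, the gains add up. -/
theorem IsContent.exists_blocks [BorelSpace X] [IsFiniteMeasure μ] (hh : IsContent μ h M)
    {ι : Type*} (I : Finset ι) (lev : ι → ℤ) (V Y : ι → Set X) (ρ w : ι → ℝ)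
    (hρ : ∀ i ∈ I, 0 < ρ i) (hYV : ∀ i ∈ I, Y i ⊆ V i)
    (hsep : ∀ i ∈ I, ∀ j ∈ I, i ≠ j → lev j ≤ lev i →
      Disjoint (V i) (V j) ∨ ∀ p ∈ V j, ∀ q ∈ V j, dist p q < ρ i)
    (hgain : ∀ i ∈ I, ∀ A B, MeasurableSet A → MeasurableSet B →
      innerCore (ρ i) (Y i) ⊆ A → A ⊆ Y i →
      innerCore (ρ i) (V i \ Y i) ⊆ B → B ⊆ V i \ Y i →
      w i ≤ μ.real A * (h A / μ.real A - h (A ∪ B) / μ.real (A ∪ B)) ^ 2) :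
    ∃ 𝓑 : Finset (Set X), (𝓑 : Set (Set X)).PairwiseDisjoint id ∧
      (∀ B ∈ 𝓑, MeasurableSet B) ∧ (∀ B ∈ 𝓑, ∃ i ∈ I, B ⊆ V i) ∧
      ∑ i ∈ I, w i ≤ ∑ B ∈ 𝓑, defect μ h M B := by
  classical
  induction I using Finset.induction_on_max_value lev with
  | empty => exact ⟨∅, by simp, by simp, by simp, by simp⟩
  | insert i I hi hmax ih =>
    obtain ⟨𝓑, hdisj, hmeas, hV, hsum⟩ := ih
      (fun j hj => hρ j (Finset.mem_insert_of_mem hj))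
      (fun j hj => hYV j (Finset.mem_insert_of_mem hj))
      (fun j hj l hl => hsep j (Finset.mem_insert_of_mem hj) l (Finset.mem_insert_of_mem hl))
      (fun j hj => hgain j (Finset.mem_insert_of_mem hj))
    have hii := Finset.mem_insert_self i I
    have hρi := hρ i hii
    set P := innerCore (ρ i) (Y i) with hP
    set R := innerCore (ρ i) (V i \ Y i) with hR
    have hPY : P ⊆ Y i := innerCore_subset hρi _
    have hRZ : R ⊆ V i \ Y i := innerCore_subset hρi _
    have hmP : MeasurableSet P := measurableSet_innerCore _ _
    have hmR : MeasurableSet R := measurableSet_innerCore _ _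
    have hsmall : ∀ B ∈ 𝓑, ∀ x ∈ B, x ∈ V i → ∀ p ∈ B, ∀ q ∈ B, dist p q < ρ i := by
      intro B hB x hx hxV p hp q hq
      obtain ⟨j, hj, hBj⟩ := hV B hB
      have hne : i ≠ j := by rintro rfl; exact hi hj
      rcases hsep i hii j (Finset.mem_insert_of_mem hj) hne (hmax j hj) with hd | hd
      · exact absurd (hBj hx) (Set.disjoint_left.1 hd hxV)
      · exact hd p (hBj hp) q (hBj hq)
    set 𝓨 := 𝓑.filter fun B => ¬ Disjoint B P with h𝓨
    set 𝓩 := 𝓑.filter fun B => ¬ Disjoint B R with h𝓩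
    set 𝓡 := 𝓑.filter fun B => Disjoint B P ∧ Disjoint B R with h𝓡
    have hY𝓨 : ∀ B ∈ 𝓨, B ⊆ Y i := by
      intro B hB
      obtain ⟨hB, hBP⟩ := Finset.mem_filter.1 hB
      obtain ⟨x, hxB, hxP⟩ := Set.not_disjoint_iff.1 hBP
      exact subset_of_mem_innerCore hxP hxB
        (hsmall B hB x hxB (hYV i hii (hPY hxP)))
    have hZ𝓩 : ∀ B ∈ 𝓩, B ⊆ V i \ Y i := by
      intro B hB
      obtain ⟨hB, hBP⟩ := Finset.mem_filter.1 hB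
      obtain ⟨x, hxB, hxP⟩ := Set.not_disjoint_iff.1 hBP
      exact subset_of_mem_innerCore hxP hxB (hsmall B hB x hxB (hRZ hxP).1)
    set A := P ∪ ⋃₀ (𝓨 : Set (Set X)) with hA
    set B := R ∪ ⋃₀ (𝓩 : Set (Set X)) with hB
    have hm𝓨 : ∀ B ∈ 𝓨, MeasurableSet B := fun B hB => hmeas B (Finset.mem_filter.1 hB).1
    have hm𝓩 : ∀ B ∈ 𝓩, MeasurableSet B := fun B hB => hmeas B (Finset.mem_filter.1 hB).1
    have hmA : MeasurableSet A := hmP.union (.sUnion 𝓨.countable_toSet hm𝓨)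
    have hmB : MeasurableSet B := hmR.union (.sUnion 𝓩.countable_toSet hm𝓩)
    have hAY : A ⊆ Y i := union_subset hPY (sUnion_subset hY𝓨)
    have hBZ : B ⊆ V i \ Y i := union_subset hRZ (sUnion_subset hZ𝓩)
    have hAB : Disjoint A B := by
      rw [Set.disjoint_left]
      exact fun x hxA hxB => (hBZ hxB).2 (hAY hxA)
    have hg := hgain i hii A B hmA hmB subset_union_left hAY subset_union_left hBZ
    have hd𝓨 : (𝓨 : Set (Set X)).PairwiseDisjoint id :=
      hdisj.subset (by simp [h𝓨, Set.subset_def]; tauto)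
    have hd𝓩 : (𝓩 : Set (Set X)).PairwiseDisjoint id :=
      hdisj.subset (by simp [h𝓩, Set.subset_def]; tauto)
    have hs𝓨 := hh.sum_defect_le 𝓨 hm𝓨 hd𝓨 hmA
      (fun B hB => (subset_sUnion_of_mem (Finset.mem_coe.2 hB)).trans subset_union_right)
    have hs𝓩 := hh.sum_defect_le 𝓩 hm𝓩 hd𝓩 hmB
      (fun B hB => (subset_sUnion_of_mem (Finset.mem_coe.2 hB)).trans subset_union_right)
    have hmerge := hh.defect_union hAB hmB
    have hsplit : ∑ B ∈ 𝓑, defect μ h M B ≤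
        ∑ B ∈ 𝓨, defect μ h M B + ∑ B ∈ 𝓩, defect μ h M B + ∑ B ∈ 𝓡, defect μ h M B := by
      rw [h𝓨, h𝓩, h𝓡, Finset.sum_filter, Finset.sum_filter, Finset.sum_filter,
        ← Finset.sum_add_distrib, ← Finset.sum_add_distrib]
      refine Finset.sum_le_sum fun B _ => ?_
      have := hh.defect_nonneg B
      by_cases h1 : Disjoint B P <;> by_cases h2 : Disjoint B R <;> simp [h1, h2, this]
    have h𝓡disj : ∀ B' ∈ 𝓡, Disjoint (A ∪ B) B' := by
      intro B' hB'
      obtain ⟨hB'𝓑, hB'P, hB'R⟩ := Finset.mem_filter.1 hB'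
      have hne : ∀ B'' ∈ 𝓑, (¬ Disjoint B'' P ∨ ¬ Disjoint B'' R) → Disjoint B'' B' := by
        intro B'' hB'' hor
        refine hdisj hB'' hB'𝓑 ?_
        rintro rfl
        tauto
      simp only [hA, hB, disjoint_union_left, disjoint_sUnion_left]
      refine ⟨⟨hB'P.symm, fun B'' hB'' => ?_⟩, hB'R.symm, fun B'' hB'' => ?_⟩
      · exact hne B'' (Finset.mem_filter.1 hB'').1 (Or.inl (Finset.mem_filter.1 hB'').2)
      · exact hne B'' (Finset.mem_filter.1 hB'').1 (Or.inr (Finset.mem_filter.1 hB'').2)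
    rw [Finset.sum_insert hi]
    by_cases hnot : A ∪ B ∈ 𝓡
    · have hemp : A ∪ B = ∅ := by simpa using h𝓡disj _ hnot
      obtain ⟨hAe, -⟩ := union_empty_iff.1 hemp
      rw [hAe] at hg
      refine ⟨𝓑, hdisj, hmeas, fun B hB => ?_, ?_⟩
      · obtain ⟨j, hj, hj'⟩ := hV B hB
        exact ⟨j, Finset.mem_insert_of_mem hj, hj'⟩
      · simp at hg
        linarith
    · refine ⟨insert (A ∪ B) 𝓡, ?_, ?_, ?_, ?_⟩
      · rw [Finset.coe_insert]
        refine (hdisj.subset (Finset.coe_subset.2 (Finset.filter_subset _ _))).insert ?_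
        exact fun B' hB' _ => h𝓡disj B' hB'
      · intro B' hB'
        rcases Finset.mem_insert.1 hB' with rfl | hB'
        · exact hmA.union hmB
        · exact hmeas _ (Finset.mem_filter.1 hB').1
      · intro B' hB'
        rcases Finset.mem_insert.1 hB' with rfl | hB'
        · exact ⟨i, hii, union_subset (hAY.trans (hYV i hii)) (hBZ.trans sdiff_subset)⟩
        · obtain ⟨j, hj, hj'⟩ := hV _ (Finset.mem_filter.1 hB').1
          exact ⟨j, Finset.mem_insert_of_mem hj, hj'⟩
      · rw [Finset.sum_insert hnot]
        linarith

/-- A set almost exhausted by a subset has almost the same density as the subset. -/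
lemma IsContent.abs_ratio_sub_le (hh : IsContent μ h M) [IsFiniteMeasure μ] {A Y : Set X}
    {ε : ℝ} (hAY : A ⊆ Y) (hε : μ.real (Y \ A) ≤ ε * μ.real Y) (hY : 0 < μ.real Y)
    (hε1 : ε < 1) : |h Y / μ.real Y - h A / μ.real A| ≤ M * ε := by
  have h1 : μ.real Y ≤ μ.real A + μ.real (Y \ A) := by
    conv_lhs => rw [← union_sdiff_cancel hAY]
    exact measureReal_union_le _ _
  have h2 : h Y ≤ h A + h (Y \ A) := by
    conv_lhs => rw [← union_sdiff_cancel hAY]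
    exact hh.union_le _ _
  have h3 := hh.le_mul (Y \ A)
  have h4 := hh.mono A Y hAY
  have h5 : μ.real A ≤ μ.real Y := measureReal_mono hAY
  have hA : 0 < μ.real A := by nlinarith
  have hM := hh.M_nonneg
  have h6 := hh.le_mul A
  have h7 := hh.nonneg A
  set m := μ.real Y
  set m' := μ.real A
  set θ := h A / m' with hθ
  have hθ' : h A = θ * m' := by rw [hθ]; field_simp
  have hθM : θ ≤ M := by rw [hθ, div_le_iff₀ hA]; exact h6
  have hθ0 : 0 ≤ θ := by positivity
  have h8 : h (Y \ A) ≤ M * (ε * m) := h3.trans (by gcongr)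
  rw [abs_le]
  constructor
  · rw [neg_le_sub_iff_le_add, ← sub_le_iff_le_add, le_div_iff₀ hY]
    have : θ * (m - m') ≤ M * (ε * m) := by
      apply mul_le_mul hθM (by linarith) (by linarith) hM
    nlinarith
  · rw [sub_le_iff_le_add, div_le_iff₀ hY]
    nlinarith

end Energy

/-- `n`-regularity of `μ` at the points of `K`, at scales below `RK`. -/
structure RegularOn (μ : Measure X) (K : Set X) (n : ℕ) (C RK : ℝ) : Prop where
  one_lt : 1 < C
  lower : ∀ x ∈ K, ∀ r : ℝ, 0 < r → r < RK → C⁻¹ * r ^ n ≤ μ.real (closedBall x r)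
  upper : ∀ x ∈ K, ∀ r : ℝ, 0 < r → r < RK → μ.real (closedBall x r) ≤ C * r ^ n

lemma RegularOn.pow_le (hreg : RegularOn μ K n C RK) {x : X} (hx : x ∈ K) {r : ℝ} (hr : 0 < r)
    (hrK : r < RK) : r ^ n ≤ C * μ.real (closedBall x r) := by
  have h1 := hreg.lower x hx r hr hrK
  have hC := hreg.one_lt
  rwa [inv_mul_le_iff₀ (by linarith)] at h1

lemma RegularOn.hausdorffMeasure_le_isOpen [BorelSpace X] [TopologicalSpace.SeparableSpace X]
    [IsFiniteMeasure μ] (hreg : RegularOn μ K n C RK) (hRK : 0 < RK) {E U : Set X} (hE : E ⊆ K)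
    (hU : IsOpen U) (hEU : E ⊆ U) :
    μH[n] E ≤ ENNReal.ofReal (10 ^ n * C) * μ U := by
  have hC := hreg.one_lt
  have hstep : ∀ m : ℕ, ∃ u : Set X, ∃ r : X → ℝ, u.Countable ∧
      (∀ b ∈ u, 0 < r b ∧ 10 * r b ≤ 10 / ((m : ℝ) + 1)) ∧
      E ⊆ (⋃ b : u, closedBall (b : X) (5 * r b)) ∧
      ∑' b : u, ediam (closedBall (b : X) (5 * r b)) ^ (n : ℝ) ≤
        ENNReal.ofReal (10 ^ n * C) * μ U := by
    intro m
    have hm : (0 : ℝ) < 1 / ((m : ℝ) + 1) := by positivity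
    have hex : ∀ x : X, ∃ r : ℝ, x ∈ E → 0 < r ∧ r ≤ 1 / ((m : ℝ) + 1) ∧ r < RK ∧
        closedBall x r ⊆ U := by
      intro x
      by_cases hx : x ∈ E
      · obtain ⟨ε, hε, hεU⟩ := Metric.nhds_basis_closedBall.mem_iff.1 (hU.mem_nhds (hEU hx))
        refine ⟨min ε (min (1 / ((m : ℝ) + 1)) (RK / 2)), fun _ => ⟨?_, ?_, ?_, ?_⟩⟩
        · exact lt_min hε (lt_min hm (half_pos hRK))
        · exact (min_le_right _ _).trans (min_le_left _ _)
        · exact ((min_le_right _ _).trans (min_le_right _ _)).trans_lt (half_lt_self hRK)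
        · exact (closedBall_subset_closedBall (min_le_left _ _)).trans hεU
      · exact ⟨0, fun h => absurd h hx⟩
    choose r hr using hex
    obtain ⟨u, huE, hdisj, hcov⟩ := Vitali.exists_disjoint_subfamily_covering_enlargement_closedBall
      E id r (1 / ((m : ℝ) + 1)) (fun x hx => (hr x hx).2.1) 5 (by norm_num)
    have hucount : u.Countable := by
      refine hdisj.countable_of_nonempty_interior fun b hb => ⟨b, ?_⟩
      exact ball_subset_interior_closedBall (mem_ball_self (hr b (huE hb)).1)
    refine ⟨u, r, hucount, fun b hb => ⟨(hr b (huE hb)).1, ?_⟩, ?_, ?_⟩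
    · have := (hr b (huE hb)).2.1
      calc 10 * r b ≤ 10 * (1 / ((m : ℝ) + 1)) := by gcongr
        _ = _ := by ring
    · intro x hx
      obtain ⟨b, hb, hsub⟩ := hcov x hx
      exact mem_iUnion.2 ⟨⟨b, hb⟩, hsub (mem_closedBall_self (hr x hx).1.le)⟩
    · have hle : ∀ b : u, ediam (closedBall (b : X) (5 * r b)) ^ (n : ℝ) ≤
          ENNReal.ofReal (10 ^ n * C) * μ (closedBall (b : X) (r b)) := by
        intro b
        obtain ⟨hr0, -, hrK, -⟩ := hr b (huE b.2)
        have h1 : ediam (closedBall (b : X) (5 * r b)) ≤ ENNReal.ofReal (10 * r b) := by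
          refine ediam_le_of_forall_dist_le fun p hp q hq => ?_
          have := dist_triangle_right p q (b : X)
          have hp' := mem_closedBall.1 hp
          have hq' := mem_closedBall.1 hq
          linarith
        have h2 := hreg.pow_le (hE (huE b.2)) hr0 hrK
        rw [ENNReal.rpow_natCast]
        calc ediam (closedBall (b : X) (5 * r b)) ^ n ≤ ENNReal.ofReal (10 * r b) ^ n := by
              gcongr
          _ = ENNReal.ofReal ((10 * r b) ^ n) := by
              rw [ENNReal.ofReal_pow (by positivity)]
          _ ≤ ENNReal.ofReal (10 ^ n * C * μ.real (closedBall (b : X) (r b))) := by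
              apply ENNReal.ofReal_le_ofReal
              rw [mul_pow, mul_assoc]
              gcongr
          _ = _ := by
              rw [ENNReal.ofReal_mul (by positivity), ofReal_measureReal]
      have : Countable u := hucount.to_subtype
      calc ∑' b : u, ediam (closedBall (b : X) (5 * r b)) ^ (n : ℝ)
          ≤ ∑' b : u, ENNReal.ofReal (10 ^ n * C) * μ (closedBall (b : X) (r b)) :=
            ENNReal.tsum_le_tsum hle
        _ = ENNReal.ofReal (10 ^ n * C) * ∑' b : u, μ (closedBall (b : X) (r b)) :=
            ENNReal.tsum_mul_left
        _ = ENNReal.ofReal (10 ^ n * C) * μ (⋃ b : u, closedBall (b : X) (r b)) := by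
            rw [measure_iUnion _ fun b => isClosed_closedBall.measurableSet]
            intro b b' hbb'
            exact hdisj b.2 b'.2 (fun h => hbb' (Subtype.ext h))
        _ ≤ _ := by
            gcongr
            exact iUnion_subset fun b => (hr b (huE b.2)).2.2.2
  choose u r hcount hr hcov hsum using hstep
  have : ∀ m, Countable (u m) := fun m => (hcount m).to_subtype
  have hlim : Tendsto (fun m : ℕ => ENNReal.ofReal (10 / ((m : ℝ) + 1))) atTop (𝓝 0) := by
    have h1 : Tendsto (fun m : ℕ => (10 : ℝ) / ((m : ℝ) + 1)) atTop (𝓝 0) := by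
      have := (tendsto_one_div_add_atTop_nhds_zero_nat (𝕜 := ℝ)).const_mul 10
      simpa [div_eq_mul_inv] using this
    simpa only [ENNReal.ofReal_zero] using ENNReal.tendsto_ofReal h1
  refine (Measure.hausdorffMeasure_le_liminf_tsum (n : ℝ) E (l := atTop)
    (fun m : ℕ => ENNReal.ofReal (10 / ((m : ℝ) + 1))) hlim
    (fun m (b : u m) => closedBall (b : X) (5 * r m b)) ?_ ?_).trans ?_
  · refine Eventually.of_forall fun m b => ?_
    refine ediam_le_of_forall_dist_le (C := 10 / ((m : ℝ) + 1)) fun p hp q hq => ?_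
    have := dist_triangle_right p q (b : X)
    have hp' := mem_closedBall.1 hp
    have hq' := mem_closedBall.1 hq
    linarith [(hr m b b.2).2]
  · exact Eventually.of_forall hcov
  · refine (liminf_le_of_frequently_le' (Frequently.of_forall hsum))

/-- On `K`, Hausdorff measure is controlled by `μ`, also for nonmeasurable sets. -/
lemma RegularOn.hausdorffMeasure_le [BorelSpace X] [TopologicalSpace.SeparableSpace X]
    [IsFiniteMeasure μ] (hreg : RegularOn μ K n C RK) (hRK : 0 < RK) {E : Set X} (hE : E ⊆ K) :
    μH[n] E ≤ ENNReal.ofReal (10 ^ n * C) * μ E := by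
  have hC := hreg.one_lt
  have hc : ENNReal.ofReal (10 ^ n * C) ≠ 0 := by
    rw [Ne, ENNReal.ofReal_eq_zero, not_le]
    positivity
  rw [← ENNReal.div_le_iff' hc ENNReal.ofReal_ne_top, E.measure_eq_iInf_isOpen μ]
  refine le_iInf fun U => le_iInf fun hEU => le_iInf fun hU => ?_
  rw [ENNReal.div_le_iff' hc ENNReal.ofReal_ne_top]
  exact hreg.hausdorffMeasure_le_isOpen hRK hE hU hEU

/-- The Hausdorff measure of the image of the part of a set in `K`, as a real number. -/
def imageContent (K : Set X) (φ : X → EuclideanSpace ℝ (Fin n)) (B : Set X) : ℝ :=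
  (μH[n] : Measure (EuclideanSpace ℝ (Fin n))).real (φ '' (B ∩ K))

lemma RegularOn.hausdorffMeasure_image_le [BorelSpace X] [TopologicalSpace.SeparableSpace X]
    [IsFiniteMeasure μ] (hreg : RegularOn μ K n C RK) (hRK : 0 < RK)
    {φ : X → EuclideanSpace ℝ (Fin n)} (hφ : LipschitzWith 1 φ) (B : Set X) :
    μH[n] (φ '' (B ∩ K)) ≤ ENNReal.ofReal (10 ^ n * C) * μ B := by
  refine (hφ.hausdorffMeasure_image_le (Nat.cast_nonneg n) _).trans ?_
  simp only [ENNReal.coe_one, ENNReal.one_rpow, one_mul]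
  refine (hreg.hausdorffMeasure_le hRK inter_subset_right).trans ?_
  gcongr
  exact inter_subset_left

lemma RegularOn.hausdorffMeasure_image_ne_top [BorelSpace X] [TopologicalSpace.SeparableSpace X]
    [IsFiniteMeasure μ] (hreg : RegularOn μ K n C RK) (hRK : 0 < RK)
    {φ : X → EuclideanSpace ℝ (Fin n)} (hφ : LipschitzWith 1 φ) (B : Set X) :
    μH[n] (φ '' (B ∩ K)) ≠ ∞ :=
  ((hreg.hausdorffMeasure_image_le hRK hφ B).trans_lt
    (ENNReal.mul_lt_top ENNReal.ofReal_lt_top (measure_lt_top μ B))).ne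

lemma RegularOn.isContent [BorelSpace X] [TopologicalSpace.SeparableSpace X]
    [IsFiniteMeasure μ] (hreg : RegularOn μ K n C RK) (hRK : 0 < RK)
    {φ : X → EuclideanSpace ℝ (Fin n)} (hφ : LipschitzWith 1 φ) :
    IsContent μ (imageContent K φ) (10 ^ n * C) where
  M_nonneg := by have := hreg.one_lt; positivity
  nonneg _ := measureReal_nonneg
  mono A B hAB := by
    have := hreg.hausdorffMeasure_image_ne_top hRK hφ B
    exact measureReal_mono (image_mono (inter_subset_inter_left _ hAB)) this
  union_le A B := by
    unfold imageContent
    rw [union_inter_distrib_right, image_union]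
    exact measureReal_union_le _ _
  le_mul A := by
    have hC := hreg.one_lt
    have h1 := hreg.hausdorffMeasure_image_le hRK hφ A
    have h2 := ENNReal.toReal_mono (ENNReal.mul_lt_top ENNReal.ofReal_lt_top
      (measure_lt_top μ A)).ne h1
    rwa [ENNReal.toReal_mul, ENNReal.toReal_ofReal (by positivity)] at h2

namespace CubeSystem

variable (D : CubeSystem X μ K n C RK a η₀) {k j : ℤ} {Q Q' Q₀ : Set X}

lemma pow_le (hk : k ≤ D.kK) : 256 * (16 : ℝ) ^ k ≤ RK := by
  refine le_trans ?_ D.size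
  rw [zpow_add₀ (by norm_num)]
  have : (16 : ℝ) ^ k ≤ 16 ^ D.kK := zpow_le_zpow_right₀ (by norm_num) hk
  norm_num
  linarith

lemma exists_center (hk : k ≤ D.kK) (hQ : Q ∈ D.cubes k) :
    ∃ z ∈ K, closedBall z ((16 : ℝ) ^ k / 16) ⊆ Q ∧ Q ⊆ closedBall z (16 * (16 : ℝ) ^ k) := by
  obtain ⟨z, hz, h1, h2⟩ := D.ball k hk Q hQ
  rw [zpow_sub₀ (by norm_num), zpow_one] at h1
  rw [zpow_add₀ (by norm_num), zpow_one, mul_comm] at h2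
  exact ⟨z, hz, h1, h2⟩

lemma nonempty (hk : k ≤ D.kK) (hQ : Q ∈ D.cubes k) : Q.Nonempty := by
  obtain ⟨z, -, h1, -⟩ := D.exists_center hk hQ
  exact ⟨z, h1 (mem_closedBall_self (by positivity))⟩

lemma dist_le (hk : k ≤ D.kK) (hQ : Q ∈ D.cubes k) {x y : X} (hx : x ∈ Q) (hy : y ∈ Q) :
    dist x y ≤ 32 * (16 : ℝ) ^ k := by
  obtain ⟨z, -, -, h2⟩ := D.exists_center hk hQ
  have := mem_closedBall.1 (h2 hx)
  have := mem_closedBall.1 (h2 hy)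
  linarith [dist_triangle_right x y z]

lemma subset_of_mem (hkj : k ≤ j) (hj : j ≤ D.kK) (hQ : Q ∈ D.cubes k) (hQ' : Q' ∈ D.cubes j)
    {x : X} (hx : x ∈ Q) (hx' : x ∈ Q') : Q ⊆ Q' := by
  rcases D.nested k j hkj hj Q hQ Q' hQ' with h | h
  · exact h
  · exact absurd (show x ∈ Q ∩ Q' from ⟨hx, hx'⟩) (by simp [h])

lemma eq_of_mem (hk : k ≤ D.kK) (hQ : Q ∈ D.cubes k) (hQ' : Q' ∈ D.cubes k)
    {x : X} (hx : x ∈ Q) (hx' : x ∈ Q') : Q = Q' :=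
  (D.subset_of_mem le_rfl hk hQ hQ' hx hx').antisymm (D.subset_of_mem le_rfl hk hQ' hQ hx' hx)

lemma pairwiseDisjoint (hk : k ≤ D.kK) : (D.cubes k).PairwiseDisjoint id := by
  intro Q hQ Q' hQ' hne
  refine Set.disjoint_left.2 fun x hx hx' => hne (D.eq_of_mem hk hQ hQ' hx hx')

lemma measure_ge [IsFiniteMeasure μ] (hreg : RegularOn μ K n C RK) (hk : k ≤ D.kK)
    (hQ : Q ∈ D.cubes k) : C⁻¹ * ((16 : ℝ) ^ k / 16) ^ n ≤ μ.real Q := by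
  obtain ⟨z, hz, h1, -⟩ := D.exists_center hk hQ
  have h16 : (0 : ℝ) < 16 ^ k := by positivity
  exact (hreg.lower z hz _ (by positivity) (by linarith [D.pow_le hk])).trans (measureReal_mono h1)

lemma measure_pos [IsFiniteMeasure μ] (hreg : RegularOn μ K n C RK) (hk : k ≤ D.kK)
    (hQ : Q ∈ D.cubes k) : 0 < μ.real Q := by
  have hC := hreg.one_lt
  refine lt_of_lt_of_le ?_ (D.measure_ge hreg hk hQ)
  have h16 : (0 : ℝ) < 16 ^ k := by positivity
  positivity

lemma measure_le [IsFiniteMeasure μ] (hreg : RegularOn μ K n C RK) (hk : k ≤ D.kK)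
    (hQ : Q ∈ D.cubes k) : μ.real Q ≤ C * (16 * (16 : ℝ) ^ k) ^ n := by
  obtain ⟨z, hz, -, h1⟩ := D.exists_center hk hQ
  have h16 : (0 : ℝ) < 16 ^ k := by positivity
  exact (measureReal_mono h1).trans
    (hreg.upper z hz _ (by positivity) (by linarith [D.pow_le hk]))

/-- The `μ`-mass of a dilated cube is controlled, provided one stays near a larger cube. -/
lemma measure_thickening_le [IsFiniteMeasure μ] (hreg : RegularOn μ K n C RK) (hkj : k ≤ j)
    (hj : j ≤ D.kK) (hQ : Q ∈ D.cubes k) (hQ₀ : Q₀ ∈ D.cubes j) {d : ℝ} (hd : 0 ≤ d) :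
    μ.real (thickening (d * 16 ^ k) Q ∩ thickening (128 * 16 ^ j) Q₀) ≤
      C * ((d + 16) * 16 ^ k) ^ n := by
  have hC := hreg.one_lt
  have h16 : (0 : ℝ) < 16 ^ k := by positivity
  have h16j : (0 : ℝ) < 16 ^ j := by positivity
  have hcov : ∀ {i : ℤ} {P : Set X} {z : X} {r : ℝ}, P ⊆ closedBall z (16 * 16 ^ i) →
      thickening (r * 16 ^ i) P ⊆ closedBall z ((r + 16) * 16 ^ i) := by
    intro i P z r h x hx
    obtain ⟨p, hp, hxp⟩ := mem_thickening_iff.1 hx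
    have := mem_closedBall.1 (h hp)
    rw [mem_closedBall]
    linarith [dist_triangle x p z]
  rcases lt_or_ge ((d + 16) * 16 ^ k) RK with h | h
  · obtain ⟨z, hz, -, h1⟩ := D.exists_center (hkj.trans hj) hQ
    exact (measureReal_mono (inter_subset_left.trans (hcov h1))).trans
      (hreg.upper z hz _ (by positivity) h)
  · obtain ⟨z, hz, -, h1⟩ := D.exists_center hj hQ₀
    have hR := D.pow_le hj
    refine ((measureReal_mono (inter_subset_right.trans (hcov h1))).trans
      (hreg.upper z hz _ (by positivity) (by linarith))).trans ?_
    exact mul_le_mul_of_nonneg_left (pow_le_pow_left₀ (by positivity) (by linarith) n) (by linarith)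

/-- A finite family of cubes of one generation inside `E` has total mass at most a multiple of
the mass of `E`; only the cores of the cubes need to be disjoint and measurable. -/
lemma sum_core_le [BorelSpace X] [IsFiniteMeasure μ] (hreg : RegularOn μ K n C RK)
    (hk : k ≤ D.kK) (F : Finset (Set X)) (hF : ∀ Q ∈ F, Q ∈ D.cubes k) {E : Set X}
    (hE : ∀ Q ∈ F, Q ⊆ E) : F.card * (C⁻¹ * ((16 : ℝ) ^ k / 16) ^ n) ≤ μ.real E := by
  have h16 : (0 : ℝ) < 16 ^ k := by positivity
  have hz : ∀ Q ∈ F, ∃ B : Set X, MeasurableSet B ∧ B ⊆ Q ∧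
      C⁻¹ * ((16 : ℝ) ^ k / 16) ^ n ≤ μ.real B := by
    intro Q hQ
    obtain ⟨z, hz, h1, -⟩ := D.exists_center hk (hF Q hQ)
    exact ⟨_, isClosed_closedBall.measurableSet, h1,
      hreg.lower z hz _ (by positivity) (by linarith [D.pow_le hk])⟩
  choose! B hB hBQ hlow using hz
  calc F.card * (C⁻¹ * ((16 : ℝ) ^ k / 16) ^ n) ≤ ∑ Q ∈ F, μ.real (B Q) := by
        rw [← nsmul_eq_mul]
        exact Finset.card_nsmul_le_sum _ _ _ hlow
    _ = μ.real (⋃ Q ∈ F, B Q) := by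
        rw [measureReal_biUnion_finset _ hB]
        intro P hP P' hP' hne
        exact (D.pairwiseDisjoint hk (hF P hP) (hF P' hP') hne).mono (hBQ P hP) (hBQ P' hP')
    _ ≤ μ.real E := measureReal_mono (iUnion₂_subset fun Q hQ => (hBQ Q hQ).trans (hE Q hQ))

lemma sum_measure_le [BorelSpace X] [IsFiniteMeasure μ] (hreg : RegularOn μ K n C RK)
    (hk : k ≤ D.kK) (F : Finset (Set X)) (hF : ∀ Q ∈ F, Q ∈ D.cubes k) {E : Set X}
    (hE : ∀ Q ∈ F, Q ⊆ E) : ∑ Q ∈ F, μ.real Q ≤ C ^ 2 * 256 ^ n * μ.real E := by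
  have hC := hreg.one_lt
  have h1 := D.sum_core_le hreg hk F hF hE
  calc ∑ Q ∈ F, μ.real Q ≤ F.card • (C * (16 * (16 : ℝ) ^ k) ^ n) :=
        Finset.sum_le_card_nsmul _ _ _ fun Q hQ => D.measure_le hreg hk (hF Q hQ)
    _ = C ^ 2 * 256 ^ n * (F.card * (C⁻¹ * ((16 : ℝ) ^ k / 16) ^ n)) := by
        rw [nsmul_eq_mul, show (16 : ℝ) * 16 ^ k = 256 * (16 ^ k / 16) by ring, mul_pow]
        field_simp
    _ ≤ _ := by gcongr

lemma finite_cubes [BorelSpace X] [IsFiniteMeasure μ] (hreg : RegularOn μ K n C RK)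
    (hk : k ≤ D.kK) : (D.cubes k).Finite := by
  by_contra hinf
  have hC := hreg.one_lt
  have h16 : (0 : ℝ) < 16 ^ k := by positivity
  set c : ℝ := C⁻¹ * ((16 : ℝ) ^ k / 16) ^ n with hc
  have hc0 : 0 < c := by positivity
  obtain ⟨N, hN⟩ := exists_nat_gt (μ.real univ / c)
  obtain ⟨F, hF, hcard⟩ := Set.Infinite.exists_subset_card_eq hinf N
  have := D.sum_core_le hreg hk F (fun Q hQ => hF hQ) (fun Q _ => subset_univ Q)
  rw [hcard] at this
  rw [div_lt_iff₀ hc0] at hN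
  linarith

lemma measure_le_mul [IsFiniteMeasure μ] (hreg : RegularOn μ K n C RK) (hk : k ≤ D.kK)
    {i : ℕ} (hkj : k ≤ j + i) (hj : j ≤ D.kK) (hQ : Q ∈ D.cubes k) (hQ' : Q' ∈ D.cubes j) :
    μ.real Q ≤ C ^ 2 * (256 * 16 ^ i) ^ n * μ.real Q' := by
  have hC := hreg.one_lt
  have h1 := D.measure_le hreg hk hQ
  have h2 := D.measure_ge hreg hj hQ'
  have h16 : (0 : ℝ) < 16 ^ j := by positivity
  have h3 : (16 : ℝ) ^ k ≤ 16 ^ j * 16 ^ i := by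
    rw [← zpow_natCast, ← zpow_add₀ (by norm_num)]
    exact zpow_le_zpow_right₀ (by norm_num) hkj
  calc μ.real Q ≤ C * (16 * (16 ^ j * 16 ^ i)) ^ n := h1.trans (by gcongr)
    _ = C ^ 2 * (256 * 16 ^ i) ^ n * (C⁻¹ * ((16 : ℝ) ^ j / 16) ^ n) := by
        rw [show (16 : ℝ) * (16 ^ j * 16 ^ i) = (256 * 16 ^ i) * (16 ^ j / 16) by ring, mul_pow]
        field_simp
    _ ≤ _ := by gcongr

end CubeSystem

lemma exists_dist_lt_of_setDist_lt {s t : Set X} (hs : s.Nonempty) (ht : t.Nonempty) {r : ℝ}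
    (h : setDist s t < r) : ∃ x ∈ s, ∃ y ∈ t, dist x y < r := by
  obtain ⟨_, ⟨x, hx, y, hy, rfl⟩, hlt⟩ := exists_lt_of_csInf_lt (hs.image2 ht) h
  exact ⟨x, hx, y, hy, hlt⟩

lemma setDist_self {s : Set X} (hs : s.Nonempty) : setDist s s ≤ 0 := by
  obtain ⟨x, hx⟩ := hs
  refine csInf_le ⟨0, ?_⟩ ⟨x, hx, x, hx, dist_self x⟩
  rintro _ ⟨x, -, y, -, rfl⟩
  exact dist_nonneg

/-- Bounded overlap in measure form. -/
lemma sum_measureReal_le_of_card_le [IsFiniteMeasure μ] {ι : Type*} (F : Finset ι)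
    (U : ι → Set X) (hU : ∀ i ∈ F, MeasurableSet (U i)) {B : Set X} (hB : MeasurableSet B)
    (hUB : ∀ i ∈ F, U i ⊆ B) {c : ℝ}
    (hcard : ∀ x, ∀ G ⊆ F, (∀ i ∈ G, x ∈ U i) → (G.card : ℝ) ≤ c) :
    ∑ i ∈ F, μ.real (U i) ≤ c * μ.real B := by
  classical
  have hint : ∀ i ∈ F, Integrable ((U i).indicator (1 : X → ℝ)) μ := fun i hi =>
    (integrable_const (1 : ℝ)).indicator (hU i hi)
  calc ∑ i ∈ F, μ.real (U i) = ∑ i ∈ F, ∫ x, (U i).indicator (1 : X → ℝ) x ∂μ :=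
        Finset.sum_congr rfl fun i hi => (integral_indicator_one (hU i hi)).symm
    _ = ∫ x, ∑ i ∈ F, (U i).indicator (1 : X → ℝ) x ∂μ := (integral_finsetSum _ hint).symm
    _ ≤ ∫ x, B.indicator (fun _ => c) x ∂μ := by
        refine integral_mono (integrable_finsetSum _ hint)
          ((integrable_const c).indicator hB) fun x => ?_
        have h1 : ∑ i ∈ F, (U i).indicator (1 : X → ℝ) x = ((F.filter (x ∈ U ·)).card : ℝ) := by
          simp [indicator_apply]
        simp only [h1]
        by_cases hx : x ∈ B
        · rw [indicator_of_mem hx]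
          exact hcard x _ (Finset.filter_subset _ _) fun i hi => (Finset.mem_filter.1 hi).2
        · rw [indicator_of_notMem hx, Finset.filter_false_of_mem]
          · simp
          · exact fun i hi hxi => hx (hUB i hi hxi)
    _ = c * μ.real B := by
        rw [integral_indicator_const _ hB, smul_eq_mul, mul_comm]

namespace CubeSystem

variable (D : CubeSystem X μ K n C RK a η₀) {k j : ℤ} {Q Q' Q₀ R S : Set X}

lemma card_le [BorelSpace X] [IsFiniteMeasure μ] (hreg : RegularOn μ K n C RK) (hkj : k ≤ j)
    (hj : j ≤ D.kK) (hQ : Q ∈ D.cubes k) (hQ₀ : Q₀ ∈ D.cubes j) {d : ℝ} (hd : 0 ≤ d)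
    (F : Finset (Set X)) (hF : ∀ P ∈ F, P ∈ D.cubes k)
    (hFQ : ∀ P ∈ F, P ⊆ thickening (d * 16 ^ k) Q) (hF₀ : ∀ P ∈ F, P ⊆ Q₀) :
    (F.card : ℝ) ≤ C ^ 2 * (16 * (d + 16)) ^ n := by
  have hC := hreg.one_lt
  have h16 : (0 : ℝ) < 16 ^ k := by positivity
  have h1 := (D.sum_core_le hreg (hkj.trans hj) F hF fun P hP =>
    subset_inter (hFQ P hP) ((hF₀ P hP).trans (self_subset_thickening
      (by positivity : (0 : ℝ) < 128 * 16 ^ j) Q₀))).trans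
    (D.measure_thickening_le hreg hkj hj hQ hQ₀ hd)
  have h2 : C * ((d + 16) * (16 : ℝ) ^ k) ^ n =
      C ^ 2 * (16 * (d + 16)) ^ n * (C⁻¹ * ((16 : ℝ) ^ k / 16) ^ n) := by
    rw [show (d + 16) * (16 : ℝ) ^ k = (16 * (d + 16)) * (16 ^ k / 16) by ring, mul_pow]
    field_simp
  rw [h2] at h1
  exact le_of_mul_le_mul_right h1 (by positivity)

lemma diam_le (hk : k ≤ D.kK) (hQ : Q ∈ D.cubes k) : diam Q ≤ 32 * (16 : ℝ) ^ k :=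
  diam_le_of_forall_dist_le (by positivity) fun _ hx _ hy => D.dist_le hk hQ hx hy

lemma isBounded (hk : k ≤ D.kK) (hQ : Q ∈ D.cubes k) : Bornology.IsBounded Q := by
  obtain ⟨z, -, -, h⟩ := D.exists_center hk hQ
  exact isBounded_closedBall.subset h

lemma le_lvl (hk : k ≤ D.kK) (hQ : Q ∈ D.cubes k) : k ≤ lvl D Q :=
  le_csSup ⟨D.kK, fun _ h => h.1⟩ ⟨hk, hQ⟩

lemma lvl_spec (hQ : IsCube D Q) : lvl D Q ≤ D.kK ∧ Q ∈ D.cubes (lvl D Q) :=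
  Int.csSup_mem hQ ⟨D.kK, fun _ h => h.1⟩

lemma eq_of_setDist_le (hk : k ≤ D.kK) (hR : R ∈ D.cubes k) (hS : S ∈ D.cubes k)
    (hd : diam R < (16 : ℝ) ^ k / 256) (h : setDist S R ≤ diam R) : S = R := by
  obtain ⟨s, hs, r, hr, hsr⟩ := exists_dist_lt_of_setDist_lt (D.nonempty hk hS)
    (D.nonempty hk hR) (h.trans_lt hd)
  obtain ⟨z, -, h1, -⟩ := D.exists_center hk hR
  have hz : z ∈ R := h1 (mem_closedBall_self (by positivity))
  have h2 := dist_le_diam_of_mem (D.isBounded hk hR) hr hz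
  have h16 : (0 : ℝ) < 16 ^ k := by positivity
  have h3 : s ∈ R := h1 (by rw [mem_closedBall]; linarith [dist_triangle s r z])
  exact D.eq_of_mem hk hS hR hs h3

lemma measure_singleton_pos [BorelSpace X] [IsFiniteMeasure μ] (hreg : RegularOn μ K 0 C RK)
    (hRK : 0 < RK) {z : X} (hz : z ∈ K) : 0 < μ {z} := by
  have hC := hreg.one_lt
  have h1 := tendsto_measure_cthickening_of_isClosed (μ := μ) (s := {z})
    ⟨1, one_pos, measure_ne_top _ _⟩ isClosed_singleton
  have h2 := (h1.mono_left (nhdsWithin_le_nhds (s := Ioi 0)))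
  have h3 : ENNReal.ofReal C⁻¹ ≤ μ {z} := by
    refine ge_of_tendsto h2 ?_
    filter_upwards [Ioo_mem_nhdsGT hRK] with r hr
    have := hreg.lower z hz r hr.1 hr.2
    rw [cthickening_singleton _ hr.1.le]
    refine (ENNReal.ofReal_le_ofReal (by simpa using this)).trans ?_
    rw [ofReal_measureReal]
  exact (ENNReal.ofReal_pos.2 (by positivity)).trans_le h3

lemma mem_cubes_pred [BorelSpace X] [IsFiniteMeasure μ] (hreg : RegularOn μ K n C RK)
    (hRK : 0 < RK) (hn : n = 0) (hk : k ≤ D.kK) (hR : R ∈ D.cubes k)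
    (hd : diam R < (16 : ℝ) ^ k / 256) : R ∈ D.cubes (k - 1) := by
  subst hn
  obtain ⟨z, hz, h1, -⟩ := D.exists_center hk hR
  have hzR : z ∈ R := h1 (mem_closedBall_self (by positivity))
  have hzT : ∃ T ∈ D.cubes (k - 1), z ∈ T := by
    by_contra hcon
    have h2 : ({z} : Set X) ⊆ K \ ⋃₀ D.cubes (k - 1) := by
      rw [singleton_subset_iff]
      exact ⟨hz, fun ⟨T, hT, hzT⟩ => hcon ⟨T, hT, hzT⟩⟩
    have h3 := measure_mono_null h2 (D.cover (k - 1) (by omega))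
    exact (measure_singleton_pos hreg hRK hz).ne' h3
  obtain ⟨T, hT, hzT⟩ := hzT
  have hTR := D.subset_of_mem (by omega) hk hT hR hzT hzR
  obtain ⟨z', -, h4, -⟩ := D.exists_center (by omega) hT
  have hz' : z' ∈ T := h4 (mem_closedBall_self (by positivity))
  have hRT : R ⊆ T := fun y hy => h4 (by
    rw [mem_closedBall, zpow_sub₀ (by norm_num), zpow_one, div_div]
    have := dist_le_diam_of_mem (D.isBounded hk hR) hy (hTR hz')
    norm_num
    linarith)
  rwa [hRT.antisymm hTR]

lemma le_diam [IsFiniteMeasure μ] (hreg : RegularOn μ K n C RK) (hn : n ≠ 0) (hk : k ≤ D.kK)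
    (hR : R ∈ D.cubes k) : (C ^ 2 * 256)⁻¹ * (16 : ℝ) ^ k ≤ diam R := by
  by_contra! hlt
  have hC := hreg.one_lt
  have h16 : (0 : ℝ) < 16 ^ k := by positivity
  obtain ⟨z, hz, h1, -⟩ := D.exists_center hk hR
  have hzR : z ∈ R := h1 (mem_closedBall_self (by positivity))
  set r : ℝ := (C ^ 2 * 256)⁻¹ * (16 : ℝ) ^ k with hr
  have hr0 : 0 < r := by positivity
  have hC2 : (C ^ 2)⁻¹ ≤ 1 := inv_le_one_of_one_le₀ (by nlinarith)
  have hr1 : r = (C ^ 2)⁻¹ / 16 * (16 ^ k / 16) := by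
    rw [hr, mul_inv]; ring
  have h2 : R ⊆ closedBall z r := fun y hy => by
    have := dist_le_diam_of_mem (D.isBounded hk hR) hy hzR
    rw [mem_closedBall]; linarith
  have hrle : r ≤ 16 ^ k := by
    rw [hr1]; nlinarith
  have h3 := (D.measure_ge hreg hk hR).trans ((measureReal_mono h2).trans
    (hreg.upper z hz r hr0 (by linarith [D.pow_le hk])))
  rw [hr1, mul_pow, ← mul_assoc] at h3
  have h4 := le_of_mul_le_mul_right h3 (by positivity)
  have h5 : ((C ^ 2)⁻¹ / 16) ^ n ≤ (C ^ 2)⁻¹ / 16 :=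
    pow_le_of_le_one (by positivity) (by linarith) hn
  have h6 : C * ((C ^ 2)⁻¹ / 16) ^ n ≤ C * ((C ^ 2)⁻¹ / 16) := by gcongr
  have h7 : C * ((C ^ 2)⁻¹ / 16) = C⁻¹ / 16 := by field_simp
  have h8 : 0 < C⁻¹ := by positivity
  linarith

/-- Every nondegenerate cube has a generation comparable with its diameter, and its `hat` is
made of cubes of that generation. -/
lemma exists_scale [BorelSpace X] [IsFiniteMeasure μ] (hreg : RegularOn μ K n C RK)
    (hRK : 0 < RK) (hR : IsCube D R) (hd : 0 < diam R) :
    ∃ r ≤ D.kK, R ∈ D.cubes r ∧ (C ^ 2 * 256)⁻¹ * (16 : ℝ) ^ r ≤ diam R ∧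
      ∀ Q₀, ∃ 𝒯 ⊆ D.cubes r, R ∈ 𝒯 ∧ hat D Q₀ R = ⋃₀ 𝒯 ∩ Q₀ ∧
        ∀ S ∈ 𝒯, setDist S R ≤ diam R := by
  have hC := hreg.one_lt
  obtain ⟨hl, hRl⟩ := D.lvl_spec hR
  have hself : setDist R R ≤ diam R := (setDist_self (D.nonempty hl hRl)).trans diam_nonneg
  by_cases h : (C ^ 2 * 256)⁻¹ * (16 : ℝ) ^ lvl D R ≤ diam R
  · exact ⟨lvl D R, hl, hRl, h, fun Q₀ => ⟨{S | S ∈ D.cubes (lvl D R) ∧ setDist S R ≤ diam R},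
      fun S hS => hS.1, ⟨hRl, hself⟩, rfl, fun S hS => hS.2⟩⟩
  have hn : n = 0 := by
    by_contra hn
    exact h (D.le_diam hreg hn hl hRl)
  have hsmall : ∀ r : ℤ, (C ^ 2 * 256)⁻¹ * (16 : ℝ) ^ r ≤ 16 ^ r / 256 := by
    intro r
    have h16 : (0 : ℝ) < 16 ^ r := by positivity
    have hC2 : (C ^ 2)⁻¹ ≤ 1 := inv_le_one_of_one_le₀ (by nlinarith)
    rw [mul_inv]
    nlinarith
  have hhat : ∀ Q₀, hat D Q₀ R = ⋃₀ {R} ∩ Q₀ := by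
    intro Q₀
    unfold hat
    congr 2
    ext S
    simp only [mem_ofPred_eq, mem_singleton_iff]
    constructor
    · rintro ⟨hS, hSR⟩
      exact D.eq_of_setDist_le hl hRl hS (by linarith [hsmall (lvl D R)]) hSR
    · rintro rfl
      exact ⟨hRl, hself⟩
  by_contra! hcon
  have hlow : ∀ r ≤ D.kK, R ∈ D.cubes r → diam R < (16 : ℝ) ^ r / 256 := by
    intro r hr hRr
    by_contra! hge
    obtain ⟨Q₀, hQ₀⟩ := hcon r hr hRr ((hsmall r).trans hge)
    obtain ⟨S, hS, hlt⟩ := hQ₀ {R} (by simpa using hRr) rfl (hhat Q₀)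
    rw [mem_singleton_iff.1 hS] at hlt
    linarith
  have hdesc : ∀ m : ℕ, R ∈ D.cubes (lvl D R - m) := by
    intro m
    induction m with
    | zero => simpa using hRl
    | succ m ih =>
      have := D.mem_cubes_pred hreg hRK hn (by omega) ih (hlow _ (by omega) ih)
      rwa [Nat.cast_succ, ← sub_sub]
  obtain ⟨m, hm⟩ := exists_pow_lt_of_lt_one (x := diam R / 16 ^ lvl D R) (by positivity)
    (by norm_num : (1 / 16 : ℝ) < 1)
  have h1 := hlow _ (by omega) (hdesc m)
  rw [lt_div_iff₀ (by positivity)] at hm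
  rw [zpow_sub₀ (by norm_num), zpow_natCast] at h1
  rw [one_div_pow, one_div_mul_eq_div] at hm
  have h16 : (0 : ℝ) < 16 ^ lvl D R / 16 ^ m := by positivity
  linarith

end CubeSystem

lemma sum_sub_shift_le {f : ℕ → ℝ} {M : ℝ} (h0 : ∀ e, 0 ≤ f e) (hM : ∀ e, f e ≤ M) (i L : ℕ) :
    ∑ e ∈ Finset.range L, (f e - f (e + i)) ≤ i * M := by
  induction i with
  | zero => simp
  | succ i ih =>
    have h1 : ∑ e ∈ Finset.range L, (f (e + i) - f (e + 1 + i)) = f (0 + i) - f (L + i) :=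
      Finset.sum_range_sub' (fun e => f (e + i)) L
    have h2 : ∑ e ∈ Finset.range L, (f e - f (e + (i + 1))) =
        ∑ e ∈ Finset.range L, (f e - f (e + i)) +
          ∑ e ∈ Finset.range L, (f (e + i) - f (e + 1 + i)) := by
      rw [← Finset.sum_add_distrib]
      refine Finset.sum_congr rfl fun e _ => ?_
      rw [show e + 1 + i = e + (i + 1) by ring]
      ring
    rw [h2, h1, Nat.cast_succ]
    linarith [h0 (L + i), hM (0 + i)]

lemma exists_sum_eq_sum_range {ι : Type*} (F : Finset ι) (e : ι → ℕ) (w : ι → ℝ) :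
    ∃ L, ∑ i ∈ F, w i = ∑ m ∈ Finset.range L, ∑ i ∈ F with e i = m, w i := by
  refine ⟨F.sup e + 1, (Finset.sum_fiberwise_of_maps_to (fun i hi => ?_) w).symm⟩
  rw [Finset.mem_range, Nat.lt_succ_iff]
  exact Finset.le_sup hi

namespace CubeSystem

variable (D : CubeSystem X μ K n C RK a η₀) {k j l : ℤ} {Q Q' Q₀ R S T : Set X} {d : ℝ}

/-- The cubes of generation `j` in `S` coming closer than `d * 16 ^ j` to the complement
of `S`. -/
def boundaryCubes (S : Set X) (j : ℤ) (d : ℝ) : Set (Set X) :=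
  {T | T ∈ D.cubes j ∧ T ⊆ S ∧ ∃ t ∈ T, ∃ y ∉ S, dist t y < d * 16 ^ j}

lemma sUnion_boundaryCubes_subset : ⋃₀ D.boundaryCubes S j d ⊆ S :=
  sUnion_subset fun _ hT => hT.2.1

lemma sUnion_boundaryCubes_mono (hd : 0 ≤ d) (hl : l ≤ D.kK) (hS : S ∈ D.cubes l) (hkj : k ≤ j)
    (hjl : j ≤ l) : ⋃₀ D.boundaryCubes S k d ⊆ ⋃₀ D.boundaryCubes S j d := by
  rintro x ⟨T', ⟨hT', hTS, t, ht, y, hy, hty⟩, hx⟩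
  obtain ⟨T, ⟨hT, hTT⟩, -⟩ := D.ancestor k (by omega) T' hT' j hkj (by omega)
  refine ⟨T, ⟨hT, D.subset_of_mem hjl hl hT hS (hTT ht) (hTS ht), t, hTT ht, y, hy,
    hty.trans_le ?_⟩, hTT hx⟩
  exact mul_le_mul_of_nonneg_left (zpow_le_zpow_right₀ (by norm_num) hkj) hd

/-- Boundary layers are porous. -/
lemma measure_boundaryCubes_le_sub [BorelSpace X] [IsFiniteMeasure μ]
    (hreg : RegularOn μ K n C RK) (hd : 0 ≤ d) {i : ℕ} (hi : d + 32 ≤ 16 ^ i) (hl : l ≤ D.kK)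
    (hS : S ∈ D.cubes l) (hjl : j ≤ l) :
    μ.real (⋃₀ D.boundaryCubes S (j - (i + 2 : ℕ)) d) ≤
      (1 - (C ^ 2 * 4096 ^ n)⁻¹) * μ.real (⋃₀ D.boundaryCubes S j d) := by
  have hC := hreg.one_lt
  have h16 : (0 : ℝ) < 16 ^ j := by positivity
  have hjK : j ≤ D.kK := hjl.trans hl
  have hfin : (D.boundaryCubes S j d).Finite :=
    (D.finite_cubes hreg hjK).subset fun T hT => hT.1
  have hz : ∀ T ∈ D.boundaryCubes S j d, ∃ z ∈ K, closedBall z ((16 : ℝ) ^ j / 16) ⊆ T ∧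
      T ⊆ closedBall z (16 * (16 : ℝ) ^ j) := fun T hT => D.exists_center hjK hT.1
  have : Nonempty X := (D.nonempty hl hS).to_type
  choose! z hzK hz1 hz2 using hz
  set F := hfin.toFinset with hF
  have hFm : ∀ {T}, T ∈ F ↔ T ∈ D.boundaryCubes S j d := hfin.mem_toFinset
  set B : Set X → Set X := fun T => closedBall (z T) ((16 : ℝ) ^ j / 256) with hB
  have hBT : ∀ T ∈ F, B T ⊆ T := fun T hT =>
    (closedBall_subset_closedBall (by gcongr; norm_num)).trans (hz1 T (hFm.1 hT))
  set W : Set X := ⋃ T ∈ F, B T with hW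
  have hWm : MeasurableSet W :=
    F.measurableSet_biUnion fun T _ => isClosed_closedBall.measurableSet
  have hWsub : W ⊆ ⋃₀ D.boundaryCubes S j d :=
    iUnion₂_subset fun T hT => (hBT T hT).trans (subset_sUnion_of_mem (hFm.1 hT))
  have hWmeas : μ.real W = ∑ T ∈ F, μ.real (B T) := by
    rw [hW, measureReal_biUnion_finset]
    · intro P hP P' hP' hne
      exact (D.pairwiseDisjoint hjK (hFm.1 hP).1 (hFm.1 hP').1 hne).mono (hBT P hP) (hBT P' hP')
    · exact fun T _ => isClosed_closedBall.measurableSet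
  have hlow : (C ^ 2 * 4096 ^ n)⁻¹ * μ.real (⋃₀ D.boundaryCubes S j d) ≤ μ.real W := by
    have h1 : ∀ T ∈ F, (C ^ 2 * 4096 ^ n)⁻¹ * μ.real T ≤ μ.real (B T) := by
      intro T hT
      refine le_trans ?_ (hreg.lower (z T) (hzK T (hFm.1 hT)) _ (by positivity)
        (by linarith [D.pow_le hjK]))
      rw [inv_mul_le_iff₀ (by positivity)]
      refine (D.measure_le hreg hjK (hFm.1 hT).1).trans (le_of_eq ?_)
      rw [show (16 : ℝ) * 16 ^ j = 4096 * (16 ^ j / 256) by ring, mul_pow]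
      field_simp
    rw [hWmeas]
    refine le_trans ?_ (Finset.sum_le_sum h1)
    rw [← Finset.mul_sum]
    have h2 : μ.real (⋃₀ D.boundaryCubes S j d) ≤ ∑ T ∈ F, μ.real T := by
      have : ⋃₀ D.boundaryCubes S j d = ⋃ T ∈ F, T := by
        ext x; simp [hFm]
      rw [this]
      exact measureReal_biUnion_finset_le F id
    gcongr
  have hdisj : ⋃₀ D.boundaryCubes S (j - (i + 2 : ℕ)) d ⊆ ⋃₀ D.boundaryCubes S j d \ W := by
    intro p hp
    refine ⟨D.sUnion_boundaryCubes_mono hd hl hS (by omega) hjl hp, fun hpW => ?_⟩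
    obtain ⟨T', ⟨hT', hTS, t, ht, y, hy, hty⟩, hpT⟩ := hp
    obtain ⟨T, hT, hpB⟩ := mem_iUnion₂.1 hpW
    have h1 := D.dist_le (by omega) hT' hpT ht
    have h2 := mem_closedBall.1 hpB
    have h3 : (d + 32) * (16 : ℝ) ^ (j - (i + 2 : ℕ)) ≤ 16 ^ j / 256 := by
      rw [zpow_sub₀ (by norm_num), zpow_natCast, pow_add]
      calc (d + 32) * ((16 : ℝ) ^ j / (16 ^ i * 16 ^ 2)) ≤
          16 ^ i * ((16 : ℝ) ^ j / (16 ^ i * 16 ^ 2)) := by gcongr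
        _ = 16 ^ j / 256 := by field_simp; norm_num
    refine hy ((hFm.1 hT).2.1 (hz1 T (hFm.1 hT) ?_))
    rw [mem_closedBall, dist_comm]
    have h4 := dist_triangle (z T) p y
    have h5 := dist_triangle p t y
    rw [dist_comm (z T) p] at h4
    linarith
  have h1 := measureReal_mono (μ := μ) hdisj
  have h2 := measureReal_sdiff_add_inter (μ := μ) (s := ⋃₀ D.boundaryCubes S j d) hWm
  rw [inter_eq_self_of_subset_right hWsub] at h2
  linarith

lemma measure_boundaryCubes_le [BorelSpace X] [IsFiniteMeasure μ]
    (hreg : RegularOn μ K n C RK) (hd : 0 ≤ d) {i : ℕ} (hi : d + 32 ≤ 16 ^ i) (hl : l ≤ D.kK)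
    (hS : S ∈ D.cubes l) (m : ℕ) :
    μ.real (⋃₀ D.boundaryCubes S (l - m * (i + 2 : ℕ)) d) ≤
      (1 - (C ^ 2 * 4096 ^ n)⁻¹) ^ m * μ.real S := by
  have hC := hreg.one_lt
  have hc : (C ^ 2 * 4096 ^ n)⁻¹ ≤ 1 :=
    inv_le_one_of_one_le₀ (one_le_mul_of_one_le_of_one_le (by nlinarith)
      (one_le_pow₀ (by norm_num)))
  induction m with
  | zero => simpa using measureReal_mono (μ := μ) (D.sUnion_boundaryCubes_subset (S := S))
  | succ m ih =>
    have h := D.measure_boundaryCubes_le_sub hreg hd hi hl hS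
      (j := l - m * (i + 2 : ℕ)) (sub_le_self l (by positivity))
    rw [sub_sub, ← add_one_mul, ← Nat.cast_succ] at h
    refine (h.trans (mul_le_mul_of_nonneg_left ih (sub_nonneg.2 hc))).trans (le_of_eq ?_)
    ring

/-- Cubes coming relatively close to the complement of `Q₀` are packed. -/
lemma sum_boundaryCubes_le [BorelSpace X] [IsFiniteMeasure μ]
    (hreg : RegularOn μ K n C RK) (hd : 0 ≤ d) {i : ℕ} (hi : d + 32 ≤ 16 ^ i) (hl : l ≤ D.kK)
    (hS : S ∈ D.cubes l) (F : Finset (Set X)) (lev : Set X → ℤ)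
    (hF : ∀ Q ∈ F, lev Q ≤ l ∧ Q ∈ D.boundaryCubes S (lev Q) d) :
    ∑ Q ∈ F, μ.real Q ≤
      C ^ 2 * 256 ^ n * ((C ^ 2 * 4096 ^ n) * ((i + 2 : ℕ) * μ.real S)) := by
  have hC := hreg.one_lt
  set g : ℕ → ℝ := fun e => μ.real (⋃₀ D.boundaryCubes S (l - e) d) with hg
  have hstep : ∀ e, g e ≤ (C ^ 2 * 4096 ^ n) * (g e - g (e + (i + 2))) := by
    intro e
    have h := D.measure_boundaryCubes_le_sub hreg hd hi hl hS
      (j := l - e) (sub_le_self l (by positivity))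
    rw [sub_sub, ← Nat.cast_add] at h
    have h' : g (e + (i + 2)) ≤ (1 - (C ^ 2 * 4096 ^ n)⁻¹) * g e := h
    rw [← inv_mul_le_iff₀ (by positivity)]
    linarith
  obtain ⟨L, hL⟩ := exists_sum_eq_sum_range F (fun Q => (l - lev Q).toNat) μ.real
  rw [hL]
  calc _ ≤ ∑ e ∈ Finset.range L, C ^ 2 * 256 ^ n * g e := by
        refine Finset.sum_le_sum fun e _ => ?_
        have hlev : ∀ Q ∈ F.filter (fun Q => (l - lev Q).toNat = e), lev Q = l - e := by
          intro Q hQ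
          have h1 := (Finset.mem_filter.1 hQ).2
          have h2 := (hF Q (Finset.mem_filter.1 hQ).1).1
          omega
        have hmem : ∀ Q ∈ F.filter (fun Q => (l - lev Q).toNat = e),
            Q ∈ D.boundaryCubes S (l - e) d := fun Q hQ => by
          rw [← hlev Q hQ]
          exact (hF Q (Finset.mem_filter.1 hQ).1).2
        exact D.sum_measure_le hreg (k := l - e) (by omega) _ (fun Q hQ => (hmem Q hQ).1)
          fun Q hQ => subset_sUnion_of_mem (hmem Q hQ)
    _ ≤ ∑ e ∈ Finset.range L,
          C ^ 2 * 256 ^ n * ((C ^ 2 * 4096 ^ n) * (g e - g (e + (i + 2)))) :=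
        Finset.sum_le_sum fun e _ => mul_le_mul_of_nonneg_left (hstep e) (by positivity)
    _ ≤ _ := by
        rw [← Finset.mul_sum, ← Finset.mul_sum]
        have := sum_sub_shift_le (f := g) (M := μ.real S) (fun e => measureReal_nonneg)
          (fun e => measureReal_mono D.sUnion_boundaryCubes_subset) (i + 2) L
        gcongr

end CubeSystem

namespace CubeSystem

variable (D : CubeSystem X μ K n C RK a η₀) {k j l : ℤ} {Q Q' Q₀ R S T : Set X} {d : ℝ}

lemma measure_thickening_le_mul [IsFiniteMeasure μ] (hreg : RegularOn μ K n C RK) (hkj : k ≤ j)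
    (hj : j ≤ D.kK) (hQ : Q ∈ D.cubes k) (hQ₀ : Q₀ ∈ D.cubes j) (hd : 0 ≤ d) :
    μ.real (thickening (d * 16 ^ k) Q ∩ thickening (128 * 16 ^ j) Q₀) ≤
      C ^ 2 * (16 * (d + 16)) ^ n * μ.real Q := by
  have hC := hreg.one_lt
  refine (D.measure_thickening_le hreg hkj hj hQ hQ₀ hd).trans ?_
  have h := D.measure_ge hreg (hkj.trans hj) hQ
  calc C * ((d + 16) * (16 : ℝ) ^ k) ^ n
      = C ^ 2 * (16 * (d + 16)) ^ n * (C⁻¹ * ((16 : ℝ) ^ k / 16) ^ n) := by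
        rw [show (d + 16) * (16 : ℝ) ^ k = (16 * (d + 16)) * (16 ^ k / 16) by ring, mul_pow]
        field_simp
    _ ≤ _ := by gcongr

/-- The points near a cube of generation `l` and near its complement. -/
def strip (l : ℤ) (ρ : ℝ) : Set X :=
  ⋃ S ∈ D.cubes l, thickening ρ S ∩ thickening ρ Sᶜ

/-- The strips of width `16 ^ (k - N)` around the cubes of the generations up to `j` that are
within `m` of `k`. -/
def strips (k : ℤ) (m N : ℕ) (j : ℤ) : Set X :=
  ⋃ l ∈ Finset.Icc (k - m) (min (k + m) j), D.strip l (16 ^ (k - N))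

/-- The points that are near a cube of generation at most `j`, at the scale of that cube. -/
def near (j : ℤ) : Set X :=
  {x | ∃ i ≤ j, i ≤ D.kK ∧ ∃ T ∈ D.cubes i, x ∈ thickening (16 ^ i) T}

lemma isOpen_strip (l : ℤ) (ρ : ℝ) : IsOpen (D.strip l ρ) :=
  isOpen_biUnion fun _ _ => isOpen_thickening.inter isOpen_thickening

lemma isOpen_near (j : ℤ) : IsOpen (D.near j) := by
  have : D.near j = ⋃ i ≤ j, ⋃ (_ : i ≤ D.kK), ⋃ T ∈ D.cubes i, thickening (16 ^ i) T := by
    ext x; simp [near, and_left_comm]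
  rw [this]
  exact isOpen_biUnion fun _ _ => isOpen_iUnion fun _ => isOpen_biUnion fun _ _ =>
    isOpen_thickening

lemma near_mono (h : k ≤ j) : D.near k ⊆ D.near j := fun _ ⟨i, hi, hx⟩ => ⟨i, hi.trans h, hx⟩

lemma strips_subset_near {m N : ℕ} (hN : m ≤ N) (hj : j ≤ D.kK) :
    D.strips k m N j ⊆ D.near (k + m) := by
  intro x hx
  obtain ⟨l, hl, hx⟩ := mem_iUnion₂.1 hx
  obtain ⟨S, hS, hx, -⟩ := mem_iUnion₂.1 hx
  rw [Finset.mem_Icc, le_min_iff] at hl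
  exact ⟨l, hl.2.1, hl.2.2.trans hj, S, hS, thickening_mono
    (zpow_le_zpow_right₀ (by norm_num) (by omega)) _ hx⟩

/-- A neighbourhood of `Q` at its own scale, kept near `Q₀`. -/
def nbhd (Q : Set X) (k : ℤ) (Q₀ : Set X) (j : ℤ) (d : ℝ) : Set X :=
  thickening (d * 16 ^ k) Q ∩ thickening (16 * 16 ^ j) Q₀

lemma isOpen_nbhd (Q : Set X) (k : ℤ) (Q₀ : Set X) (j : ℤ) (d : ℝ) : IsOpen (nbhd Q k Q₀ j d) :=
  isOpen_thickening.inter isOpen_thickening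

lemma measure_biUnion_thickening_le [BorelSpace X] [IsFiniteMeasure μ]
    (hreg : RegularOn μ K n C RK) (hkj : k ≤ j) (hj : j ≤ D.kK) (hQ₀ : Q₀ ∈ D.cubes j)
    {𝒯 : Set (Set X)} (h𝒯 : 𝒯 ⊆ D.cubes k) :
    μ.real ((⋃ T ∈ 𝒯, thickening (16 ^ k) T) ∩ thickening (128 * 16 ^ j) Q₀) ≤
      C ^ 4 * (16 * (1 + 16) * 256) ^ n * μ.real (⋃₀ 𝒯) := by
  have hC := hreg.one_lt
  have hfin : 𝒯.Finite := (D.finite_cubes hreg (hkj.trans hj)).subset h𝒯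
  have hF : ∀ {T}, T ∈ hfin.toFinset ↔ T ∈ 𝒯 := hfin.mem_toFinset
  have h1 : (⋃ T ∈ 𝒯, thickening (16 ^ k) T) ∩ thickening (128 * 16 ^ j) Q₀ ⊆
      ⋃ T ∈ hfin.toFinset, (thickening (1 * 16 ^ k) T ∩ thickening (128 * 16 ^ j) Q₀) := by
    rintro x ⟨hx, hx0⟩
    obtain ⟨T, hT, hxT⟩ := mem_iUnion₂.1 hx
    exact mem_iUnion₂.2 ⟨T, hF.2 hT, by rwa [one_mul], hx0⟩
  calc _ ≤ ∑ T ∈ hfin.toFinset,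
          μ.real (thickening (1 * 16 ^ k) T ∩ thickening (128 * 16 ^ j) Q₀) :=
        (measureReal_mono h1 (measure_ne_top _ _)).trans (measureReal_biUnion_finset_le _ _)
    _ ≤ ∑ T ∈ hfin.toFinset, C ^ 2 * (16 * (1 + 16)) ^ n * μ.real T :=
        Finset.sum_le_sum fun T hT =>
          D.measure_thickening_le_mul hreg hkj hj (h𝒯 (hF.1 hT)) hQ₀ zero_le_one
    _ ≤ C ^ 2 * (16 * (1 + 16)) ^ n * (C ^ 2 * 256 ^ n * μ.real (⋃₀ 𝒯)) := by
        rw [← Finset.mul_sum]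
        gcongr
        exact D.sum_measure_le hreg (hkj.trans hj) _ (fun T hT => h𝒯 (hF.1 hT))
          fun T hT => subset_sUnion_of_mem (hF.1 hT)
    _ = _ := by
        rw [mul_pow (16 * (1 + 16) : ℝ)]
        ring

lemma exists_boundaryCube {N m : ℕ} (hN : m ≤ N) (hj : j ≤ D.kK) (hlk : k - m ≤ l)
    (hlj : l ≤ j) {x : X} (hx : x ∈ D.strip l (16 ^ (k - N))) (hx' : x ∈ D.near (k - N)) :
    ∃ S ∈ D.cubes l, ∃ T ∈ D.boundaryCubes S (k - N) 2, x ∈ thickening (16 ^ (k - N)) T := by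
  obtain ⟨S, hS, hxS, hxS'⟩ := mem_iUnion₂.1 hx
  obtain ⟨p, hp, hxp⟩ := mem_thickening_iff.1 hxS
  obtain ⟨y, hy, hxy⟩ := mem_thickening_iff.1 hxS'
  obtain ⟨i, hi, hiK, T', hT', hxT'⟩ := hx'
  obtain ⟨t, ht, hxt⟩ := mem_thickening_iff.1 hxT'
  obtain ⟨T, ⟨hT, hTT⟩, -⟩ := D.ancestor i hiK T' hT' (k - N) hi (by omega)
  obtain ⟨S', ⟨hS', hTS'⟩, -⟩ := D.ancestor (k - N) (by omega) T hT l (by omega) (by omega)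
  have hxt' : dist x t < 16 ^ (k - N) :=
    hxt.trans_le (zpow_le_zpow_right₀ (by norm_num) hi)
  refine ⟨S', hS', T, ⟨hT, hTS', t, hTT ht, ?_⟩, mem_thickening_iff.2 ⟨t, hTT ht, hxt'⟩⟩
  by_cases hSS : S' = S
  · subst hSS
    exact ⟨y, hy, by linarith [dist_triangle_left t y x]⟩
  · exact ⟨p, fun hpS' => hSS (D.eq_of_mem (by omega) hS' hS hpS' hp),
      by linarith [dist_triangle_left t p x]⟩

/-- The part of the strips accumulating at very small cubes is small. -/
lemma measure_strips_inter_near_le [BorelSpace X] [IsFiniteMeasure μ]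
    (hreg : RegularOn μ K n C RK) (hkj : k ≤ j) (hj : j ≤ D.kK) (hQ : Q ∈ D.cubes k)
    (hQ₀ : Q₀ ∈ D.cubes j) (hd : 0 ≤ d) {m N p : ℕ} (hN : m + p * 4 ≤ N) :
    μ.real (nbhd Q k Q₀ j d ∩ D.strips k m N j ∩ D.near (k - N)) ≤
      (2 * m + 1 : ℕ) * (C ^ 8 * (16 * (1 + 16) * 256 * 256 * (16 * (d + 1 + 32 * 16 ^ m + 16))) ^ n *
        (1 - (C ^ 2 * 4096 ^ n)⁻¹) ^ p) * μ.real Q := by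
  have hC := hreg.one_lt
  have h16 : (0 : ℝ) < 16 ^ k := by positivity
  have h16j : (0 : ℝ) < 16 ^ j := by positivity
  have hkN : (16 : ℝ) ^ (k - N) ≤ 16 ^ k := zpow_le_zpow_right₀ (by norm_num) (by omega)
  have hkj' : (16 : ℝ) ^ k ≤ 16 ^ j := zpow_le_zpow_right₀ (by norm_num) hkj
  set d' : ℝ := d + 1 + 32 * 16 ^ m with hd'
  have hd'0 : 0 ≤ d' := by positivity
  set W : Set X := thickening (d' * 16 ^ k) Q ∩ thickening (128 * 16 ^ j) Q₀ with hW
  set q : ℝ := (1 - (C ^ 2 * 4096 ^ n)⁻¹) ^ p with hq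
  have hc : (C ^ 2 * 4096 ^ n)⁻¹ ≤ 1 :=
    inv_le_one_of_one_le₀ (one_le_mul_of_one_le_of_one_le (by nlinarith)
      (one_le_pow₀ (by norm_num)))
  have hq0 : 0 ≤ q := pow_nonneg (sub_nonneg.2 hc) _
  set E : Set X → Set X := fun S => (⋃ T ∈ D.boundaryCubes S (k - N) 2,
    thickening (16 ^ (k - N)) T) ∩ thickening (128 * 16 ^ j) Q₀ with hE
  have hES : ∀ l, k - m ≤ l → l ≤ j → ∀ S ∈ D.cubes l,
      μ.real (E S) ≤ C ^ 4 * (16 * (1 + 16) * 256) ^ n * (q * μ.real S) := by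
    intro l hlk hlj S hS
    refine (D.measure_biUnion_thickening_le hreg (by omega) hj hQ₀ fun T hT => hT.1).trans ?_
    gcongr
    refine le_trans (measureReal_mono (D.sUnion_boundaryCubes_mono zero_le_two (hlj.trans hj) hS
      (j := l - p * (2 + 2 : ℕ)) (by push_cast; omega) (by push_cast; omega))) ?_
    exact D.measure_boundaryCubes_le hreg zero_le_two (by norm_num) (hlj.trans hj) hS p
  set I := Finset.Icc (k - m) (min (k + m) j) with hI
  have hlev : ∀ l ∈ I, ∃ 𝒮 : Finset (Set X), (∀ S ∈ 𝒮, S ∈ D.cubes l) ∧ (∀ S ∈ 𝒮, S ⊆ W) ∧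
      nbhd Q k Q₀ j d ∩ D.strip l (16 ^ (k - N)) ∩ D.near (k - N) ⊆ ⋃ S ∈ 𝒮, E S := by
    intro l hl
    rw [hI, Finset.mem_Icc, le_min_iff] at hl
    have hfin : {S ∈ D.cubes l | S ⊆ W}.Finite :=
      (D.finite_cubes hreg (hl.2.2.trans hj)).subset fun S hS => hS.1
    refine ⟨hfin.toFinset, fun S hS => (hfin.mem_toFinset.1 hS).1,
      fun S hS => (hfin.mem_toFinset.1 hS).2, ?_⟩
    rintro x ⟨⟨⟨hxQ, hxQ₀⟩, hxs⟩, hxn⟩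
    obtain ⟨S, hS, T, hT, hxT⟩ := D.exists_boundaryCube (by omega) hj hl.1 hl.2.2 hxs hxn
    obtain ⟨u, hu, hxu⟩ := mem_thickening_iff.1 hxQ
    obtain ⟨v, hv, hxv⟩ := mem_thickening_iff.1 hxQ₀
    obtain ⟨t, ht, hxt⟩ := mem_thickening_iff.1 hxT
    have hl1 : (16 : ℝ) ^ l ≤ 16 ^ m * 16 ^ k := by
      rw [← zpow_natCast, ← zpow_add₀ (by norm_num)]
      exact zpow_le_zpow_right₀ (by norm_num) (by omega)
    have hl2 : (16 : ℝ) ^ l ≤ 16 ^ j := zpow_le_zpow_right₀ (by norm_num) hl.2.2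
    refine mem_iUnion₂.2 ⟨S, hfin.mem_toFinset.2 ⟨hS, fun y hy => ⟨?_, ?_⟩⟩, ?_, ?_⟩
    · have h1 := D.dist_le (hl.2.2.trans hj) hS hy (hT.2.1 ht)
      refine mem_thickening_iff.2 ⟨u, hu, ?_⟩
      rw [hd']
      linarith [dist_triangle y t u, dist_triangle_left t u x]
    · have h1 := D.dist_le (hl.2.2.trans hj) hS hy (hT.2.1 ht)
      refine mem_thickening_iff.2 ⟨v, hv, ?_⟩
      linarith [dist_triangle y t v, dist_triangle_left t v x]
    · exact mem_iUnion₂.2 ⟨T, hT, hxT⟩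
    · exact thickening_mono (by linarith) _ hxQ₀
  choose! 𝒮 h𝒮 h𝒮W h𝒮E using hlev
  have hsub : nbhd Q k Q₀ j d ∩ D.strips k m N j ∩ D.near (k - N) ⊆
      ⋃ l ∈ I, ⋃ S ∈ 𝒮 l, E S := by
    rintro x ⟨⟨hxU, hxs⟩, hxn⟩
    obtain ⟨l, hl, hxl⟩ := mem_iUnion₂.1 hxs
    exact mem_iUnion₂.2 ⟨l, hl, h𝒮E l hl ⟨⟨hxU, hxl⟩, hxn⟩⟩
  have hWQ : μ.real W ≤ C ^ 2 * (16 * (d' + 16)) ^ n * μ.real Q :=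
    D.measure_thickening_le_mul hreg hkj hj hQ hQ₀ hd'0
  have hone : ∀ l ∈ I, μ.real (⋃ S ∈ 𝒮 l, E S) ≤ C ^ 4 * (16 * (1 + 16) * 256) ^ n * (q *
      (C ^ 2 * 256 ^ n * (C ^ 2 * (16 * (d' + 16)) ^ n * μ.real Q))) := by
    intro l hl
    have hl' := hl
    rw [hI, Finset.mem_Icc, le_min_iff] at hl'
    calc _ ≤ ∑ S ∈ 𝒮 l, C ^ 4 * (16 * (1 + 16) * 256) ^ n * (q * μ.real S) :=
          (measureReal_biUnion_finset_le _ _).trans (Finset.sum_le_sum fun S hS =>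
            hES l hl'.1 hl'.2.2 S (h𝒮 l hl S hS))
      _ = C ^ 4 * (16 * (1 + 16) * 256) ^ n * (q * ∑ S ∈ 𝒮 l, μ.real S) := by
          rw [← Finset.mul_sum, ← Finset.mul_sum]
      _ ≤ _ := by
          gcongr
          refine (D.sum_measure_le hreg (hl'.2.2.trans hj) (𝒮 l) (h𝒮 l hl) (h𝒮W l hl)).trans ?_
          gcongr
  have hcard : I.card ≤ 2 * m + 1 := by
    rw [hI, Int.card_Icc]
    omega
  calc _ ≤ ∑ l ∈ I, μ.real (⋃ S ∈ 𝒮 l, E S) :=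
        (measureReal_mono hsub (measure_ne_top _ _)).trans (measureReal_biUnion_finset_le _ _)
    _ ≤ I.card • (C ^ 4 * (16 * (1 + 16) * 256) ^ n * (q *
      (C ^ 2 * 256 ^ n * (C ^ 2 * (16 * (d' + 16)) ^ n * μ.real Q)))) :=
        Finset.sum_le_card_nsmul _ _ _ hone
    _ ≤ (2 * m + 1 : ℕ) * (C ^ 4 * (16 * (1 + 16) * 256) ^ n * (q *
      (C ^ 2 * 256 ^ n * (C ^ 2 * (16 * (d' + 16)) ^ n * μ.real Q)))) := by
        rw [nsmul_eq_mul]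
        gcongr
    _ = _ := by
        rw [mul_pow (16 * (1 + 16) * 256 * 256 : ℝ), mul_pow (16 * (1 + 16) * 256 : ℝ)]
        ring

end CubeSystem

namespace CubeSystem

variable (D : CubeSystem X μ K n C RK a η₀) {k j l : ℤ} {Q Q' Q₀ R S T : Set X} {d : ℝ}

lemma thickening_subset_of_mem (hk : k ≤ D.kK) (hQ' : Q' ∈ D.cubes k)
    {x : X} (hx : x ∈ thickening (d * 16 ^ k) Q) (hx' : x ∈ thickening (d * 16 ^ k) Q') :
    Q' ⊆ thickening ((2 * d + 32) * 16 ^ k) Q := by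
  intro p hp
  obtain ⟨u, hu, hxu⟩ := mem_thickening_iff.1 hx
  obtain ⟨v, hv, hxv⟩ := mem_thickening_iff.1 hx'
  have h1 := D.dist_le hk hQ' hp hv
  refine mem_thickening_iff.2 ⟨u, hu, ?_⟩
  linarith [dist_triangle p v u, dist_triangle_left v u x]

/-- The neighbourhoods of cubes of one generation have bounded overlap. -/
lemma sum_nbhd_inter_le [BorelSpace X] [IsFiniteMeasure μ] (hreg : RegularOn μ K n C RK)
    (hkj : k ≤ j) (hj : j ≤ D.kK) (hQ₀ : Q₀ ∈ D.cubes j) (hd : 0 ≤ d) (F : Finset (Set X))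
    (hF : ∀ Q ∈ F, Q ∈ D.cubes k) (hF₀ : ∀ Q ∈ F, Q ⊆ Q₀) {E : Set X} (hE : MeasurableSet E) :
    ∑ Q ∈ F, μ.real (nbhd Q k Q₀ j d ∩ E) ≤
      C ^ 2 * (16 * (2 * d + 32 + 16)) ^ n * μ.real (thickening (16 * 16 ^ j) Q₀ ∩ E) := by
  have hC := hreg.one_lt
  refine sum_measureReal_le_of_card_le F _
    (fun Q _ => (isOpen_nbhd Q k Q₀ j d).measurableSet.inter hE)
    (isOpen_thickening.measurableSet.inter hE)
    (fun Q _ => inter_subset_inter_left _ inter_subset_right) fun x G hG hx => ?_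
  rcases G.eq_empty_or_nonempty with rfl | ⟨Q, hQ⟩
  · simp only [Finset.card_empty, Nat.cast_zero]
    positivity
  · exact D.card_le hreg hkj hj (hF Q (hG hQ)) hQ₀ (by positivity) G (fun P hP => hF P (hG hP))
      (fun P hP => D.thickening_subset_of_mem (hkj.trans hj) (hF P (hG hP))
        (hx Q hQ).1.1 (hx P hP).1.1) fun P hP => hF₀ P (hG hP)

lemma measure_thickening_self_le [IsFiniteMeasure μ] (hreg : RegularOn μ K n C RK)
    (hj : j ≤ D.kK) (hQ₀ : Q₀ ∈ D.cubes j) :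
    μ.real (thickening (16 * 16 ^ j) Q₀) ≤ C ^ 2 * 512 ^ n * μ.real Q₀ := by
  have h := D.measure_thickening_le_mul hreg le_rfl hj hQ₀ hQ₀ (d := 16) (by norm_num)
  have h16j : (0 : ℝ) < 16 ^ j := by positivity
  rw [inter_eq_self_of_subset_left (thickening_mono (by linarith) Q₀)] at h
  norm_num at h
  exact h

/-- Packing of the annular pieces `near (k + m) \ near (k - N)`. -/
lemma sum_nbhd_near_le [BorelSpace X] [IsFiniteMeasure μ] (hreg : RegularOn μ K n C RK)
    (hj : j ≤ D.kK) (hQ₀ : Q₀ ∈ D.cubes j) (hd : 0 ≤ d) (m N : ℕ) (F : Finset (Set X))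
    (lev : Set X → ℤ) (hlev : ∀ Q ∈ F, lev Q ≤ j) (hF : ∀ Q ∈ F, Q ∈ D.cubes (lev Q))
    (hF₀ : ∀ Q ∈ F, Q ⊆ Q₀) :
    ∑ Q ∈ F, μ.real (nbhd Q (lev Q) Q₀ j d ∩ (D.near (lev Q + m) \ D.near (lev Q - N))) ≤
      C ^ 2 * (16 * (2 * d + 32 + 16)) ^ n * ((m + N : ℕ) * (C ^ 2 * 512 ^ n * μ.real Q₀)) := by
  have hC := hreg.one_lt
  set B₀ := thickening (16 * 16 ^ j) Q₀ with hB₀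
  set f : ℕ → ℝ := fun e => μ.real (B₀ ∩ D.near (j + m - e)) with hf
  have hann : ∀ e : ℕ, μ.real (B₀ ∩ (D.near (j - e + m) \ D.near (j - e - N))) =
      f e - f (e + (m + N)) := by
    intro e
    have h1 := measureReal_sdiff_add_inter (μ := μ) (s := B₀ ∩ D.near (j - e + m))
      (D.isOpen_near (j - e - N)).measurableSet
    have h2 : B₀ ∩ D.near (j - e + m) ∩ D.near (j - e - N) = B₀ ∩ D.near (j - e - N) := by
      rw [inter_assoc, inter_eq_self_of_subset_right (D.near_mono (by omega))]
    rw [h2, inter_sdiff_assoc] at h1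
    rw [hf]
    simp only
    rw [show j + m - (e : ℤ) = j - e + m by ring,
      show j + m - ((e + (m + N) : ℕ) : ℤ) = j - e - N by push_cast; ring]
    linarith
  obtain ⟨L, hL⟩ := exists_sum_eq_sum_range F (fun Q => (j - lev Q).toNat) fun Q =>
    μ.real (nbhd Q (lev Q) Q₀ j d ∩ (D.near (lev Q + m) \ D.near (lev Q - N)))
  rw [hL]
  calc _ ≤ ∑ e ∈ Finset.range L,
          C ^ 2 * (16 * (2 * d + 32 + 16)) ^ n * (f e - f (e + (m + N))) := by
        refine Finset.sum_le_sum fun e _ => ?_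
        have he : ∀ Q ∈ F.filter (fun Q => (j - lev Q).toNat = e), lev Q = j - e := by
          intro Q hQ
          have h1 := (Finset.mem_filter.1 hQ).2
          have h2 := hlev Q (Finset.mem_filter.1 hQ).1
          omega
        rw [← hann, Finset.sum_congr rfl fun Q hQ => by rw [he Q hQ]]
        refine D.sum_nbhd_inter_le hreg (by omega) hj hQ₀ hd _ (fun Q hQ => ?_)
          (fun Q hQ => hF₀ Q (Finset.mem_filter.1 hQ).1)
          ((D.isOpen_near _).measurableSet.diff (D.isOpen_near _).measurableSet)
        rw [← he Q hQ]
        exact hF Q (Finset.mem_filter.1 hQ).1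
    _ ≤ _ := by
        rw [← Finset.mul_sum]
        have h1 := sum_sub_shift_le (f := f) (M := μ.real B₀) (fun e => measureReal_nonneg)
          (fun e => measureReal_mono inter_subset_left) (m + N) L
        have h2 := D.measure_thickening_self_le hreg hj hQ₀
        gcongr
        exact h1.trans (by gcongr)

/-- Cubes with a non-negligible part of their neighbourhood in thin strips are packed. -/
lemma sum_le_of_strips [BorelSpace X] [IsFiniteMeasure μ] (hreg : RegularOn μ K n C RK)
    (hj : j ≤ D.kK) (hQ₀ : Q₀ ∈ D.cubes j) (hd : 0 ≤ d) {m N p : ℕ} (hN : m + p * 4 ≤ N) {ε : ℝ}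
    (hε : 0 < ε)
    (hp : (2 * m + 1 : ℕ) * (C ^ 8 * (16 * (1 + 16) * 256 * 256 *
      (16 * (d + 1 + 32 * 16 ^ m + 16))) ^ n * (1 - (C ^ 2 * 4096 ^ n)⁻¹) ^ p) ≤ ε / 2)
    (F : Finset (Set X)) (lev : Set X → ℤ) (hlev : ∀ Q ∈ F, lev Q ≤ j)
    (hF : ∀ Q ∈ F, Q ∈ D.cubes (lev Q)) (hF₀ : ∀ Q ∈ F, Q ⊆ Q₀)
    (hbad : ∀ Q ∈ F, ε * μ.real Q <
      μ.real (nbhd Q (lev Q) Q₀ j d ∩ D.strips (lev Q) m N j)) :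
    ∑ Q ∈ F, μ.real Q ≤ 2 / ε * (C ^ 2 * (16 * (2 * d + 32 + 16)) ^ n *
      ((m + N : ℕ) * (C ^ 2 * 512 ^ n))) * μ.real Q₀ := by
  have hC := hreg.one_lt
  have hone : ∀ Q ∈ F, μ.real Q ≤ 2 / ε *
      μ.real (nbhd Q (lev Q) Q₀ j d ∩ (D.near (lev Q + m) \ D.near (lev Q - N))) := by
    intro Q hQ
    have h1 := D.measure_strips_inter_near_le hreg (hlev Q hQ) hj (hF Q hQ) hQ₀ hd hN
    have h2 := h1.trans (mul_le_mul_of_nonneg_right hp measureReal_nonneg)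
    have h3 : nbhd Q (lev Q) Q₀ j d ∩ D.strips (lev Q) m N j ⊆
        nbhd Q (lev Q) Q₀ j d ∩ (D.near (lev Q + m) \ D.near (lev Q - N)) ∪
          nbhd Q (lev Q) Q₀ j d ∩ D.strips (lev Q) m N j ∩ D.near (lev Q - N) := by
      rintro x ⟨hx, hxs⟩
      by_cases hxn : x ∈ D.near (lev Q - N)
      · exact Or.inr ⟨⟨hx, hxs⟩, hxn⟩
      · exact Or.inl ⟨hx, D.strips_subset_near (by omega) hj hxs, hxn⟩
    have h4 := (measureReal_mono (μ := μ) h3).trans (measureReal_union_le _ _)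
    have h5 := hbad Q hQ
    rw [div_mul_eq_mul_div, le_div_iff₀ hε]
    linarith
  refine (Finset.sum_le_sum hone).trans ?_
  rw [← Finset.mul_sum, mul_assoc]
  refine mul_le_mul_of_nonneg_left
    ((D.sum_nbhd_near_le hreg hj hQ₀ hd m N F lev hlev hF hF₀).trans (le_of_eq ?_)) (by positivity)
  ring

end CubeSystem

/-- A symmetric relation that is reflexive on a finite set has a maximal independent subset. -/
lemma exists_independent_dominating {α : Type*} (r : α → α → Prop)
    (hsymm : ∀ a b, r a b → r b a) (F : Finset α) (hrefl : ∀ a ∈ F, r a a) :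
    ∃ I ⊆ F, (∀ a ∈ I, ∀ b ∈ I, a ≠ b → ¬ r a b) ∧ ∀ a ∈ F, ∃ b ∈ I, r a b := by
  classical
  induction F using Finset.induction_on with
  | empty => exact ⟨∅, by simp⟩
  | insert x s hx ih =>
    obtain ⟨I, hI, hind, hdom⟩ := ih fun a ha => hrefl a (Finset.mem_insert_of_mem ha)
    by_cases h : ∃ b ∈ I, r x b
    · refine ⟨I, hI.trans (Finset.subset_insert _ _), hind, fun a ha => ?_⟩
      rcases Finset.mem_insert.1 ha with rfl | ha
      exacts [h, hdom a ha]
    · push Not at h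
      refine ⟨insert x I, Finset.insert_subset_insert _ hI, fun a ha b hb hab => ?_,
        fun a ha => ?_⟩
      · rcases Finset.mem_insert.1 ha with rfl | ha' <;>
          rcases Finset.mem_insert.1 hb with rfl | hb'
        · exact absurd rfl hab
        · exact h b hb'
        · exact fun hr => h a ha' (hsymm _ _ hr)
        · exact hind a ha' b hb' hab
      · rcases Finset.mem_insert.1 ha with rfl | ha
        · exact ⟨a, Finset.mem_insert_self _ _, hrefl a (Finset.mem_insert_self _ _)⟩
        · obtain ⟨b, hb, hr⟩ := hdom a ha
          exact ⟨b, Finset.mem_insert_of_mem hb, hr⟩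

/-- A gap between the ratios on `Y` and `V` persists on large parts of `Y` and `V`. -/
lemma IsContent.gain_le {h : Set X → ℝ} {M : ℝ} (hh : IsContent μ h M) [IsFiniteMeasure μ]
    {A E Y V : Set X} {ε κ : ℝ} (hY : 0 < μ.real Y) (hV : 0 < μ.real V)
    (hAY : A ⊆ Y) (hEV : E ⊆ V) (hA : μ.real (Y \ A) ≤ ε * μ.real Y)
    (hE : μ.real (V \ E) ≤ ε * μ.real V) (hε : ε ≤ 1 / 2) (hκ : 0 ≤ κ) (hεκ : 2 * (M * ε) ≤ κ / 2)
    (hgap : κ ≤ |h Y / μ.real Y - h V / μ.real V|) :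
    κ ^ 2 / 8 * μ.real Y ≤ μ.real A * (h A / μ.real A - h E / μ.real E) ^ 2 := by
  have h1 := hh.abs_ratio_sub_le hAY hA hY (by linarith)
  have h2 := hh.abs_ratio_sub_le hEV hE hV (by linarith)
  have h3 : κ / 2 ≤ |h A / μ.real A - h E / μ.real E| := by
    rw [abs_sub_le_iff] at h1 h2
    rcases le_abs.1 hgap with h4 | h4
    · exact le_abs.2 (Or.inl (by linarith))
    · exact le_abs.2 (Or.inr (by linarith))
  have h4 : μ.real Y / 2 ≤ μ.real A := by
    have h5 : μ.real Y ≤ μ.real (A ∪ Y \ A) := measureReal_mono (by simp)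
    have h6 := measureReal_union_le (μ := μ) A (Y \ A)
    nlinarith
  rw [← sq_abs (h A / μ.real A - h E / μ.real E)]
  calc κ ^ 2 / 8 * μ.real Y = μ.real Y / 2 * (κ / 2) ^ 2 := by ring
    _ ≤ _ := by gcongr

namespace CubeSystem

variable (D : CubeSystem X μ K n C RK a η₀) {k j l : ℤ} {Q Q' Q₀ R S T : Set X} {d : ℝ}

/-- The cubes inside `Q₀` close to `Q`, of the generations up to `j` that are within `m` of `k`. -/
def region (k : ℤ) (m : ℕ) (Q Q₀ : Set X) (j : ℤ) (d : ℝ) : Set (Set X) :=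
  {S | ∃ l, k - m ≤ l ∧ l ≤ k + m ∧ l ≤ j ∧ S ∈ D.cubes l ∧ S ⊆ Q₀ ∧
    (S ∩ thickening (d * 16 ^ k) Q).Nonempty}

lemma sUnion_region_subset (hj : j ≤ D.kK) {m : ℕ} :
    ⋃₀ D.region k m Q Q₀ j d ⊆ nbhd Q k Q₀ j (d + 32 * 16 ^ m) := by
  rintro x ⟨S, ⟨l, hl, hl', hlj, hS, hS₀, u, huS, hu⟩, hx⟩
  refine ⟨?_, self_subset_thickening (by positivity) _ (hS₀ hx)⟩
  obtain ⟨q, hq, huq⟩ := mem_thickening_iff.1 hu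
  have h1 := D.dist_le (hlj.trans hj) hS hx huS
  have h2 : (16 : ℝ) ^ l ≤ 16 ^ m * 16 ^ k := by
    rw [← zpow_natCast, ← zpow_add₀ (by norm_num)]
    exact zpow_le_zpow_right₀ (by norm_num) (by omega)
  refine mem_thickening_iff.2 ⟨q, hq, ?_⟩
  linarith [dist_triangle x u q]

lemma mem_strips {m N : ℕ} (hl : k - m ≤ l) (hl' : l ≤ k + m) (hlj : l ≤ j) (hS : S ∈ D.cubes l)
    {x : X} (hx : x ∈ thickening (16 ^ (k - N)) S) (hx' : x ∈ thickening (16 ^ (k - N)) Sᶜ) :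
    x ∈ D.strips k m N j :=
  mem_iUnion₂.2 ⟨l, Finset.mem_Icc.2 ⟨hl, le_min hl' hlj⟩, mem_iUnion₂.2 ⟨S, hS, hx, hx'⟩⟩

lemma sUnion_sdiff_innerCore_subset {m N : ℕ} {𝒯 : Set (Set X)}
    (h𝒯 : 𝒯 ⊆ D.region k m Q Q₀ j d) :
    ⋃₀ 𝒯 \ innerCore (16 ^ (k - N)) (⋃₀ 𝒯) ⊆ D.strips k m N j := by
  rintro x ⟨⟨S, hS, hxS⟩, hx⟩
  obtain ⟨l, hl, hl', hlj, hSl, -⟩ := h𝒯 hS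
  refine D.mem_strips hl hl' hlj hSl (self_subset_thickening (by positivity) _ hxS) ?_
  exact thickening_subset_of_subset _ (compl_subset_compl.2 (subset_sUnion_of_mem hS))
    (not_not.1 hx)

lemma sUnion_sdiff_innerCores_subset {m N : ℕ} {𝒯 : Set (Set X)}
    (h𝒯 : 𝒯 ⊆ D.region k m Q Q₀ j d) :
    ⋃₀ D.region k m Q Q₀ j d \ (innerCore (16 ^ (k - N)) (⋃₀ 𝒯) ∪
      innerCore (16 ^ (k - N)) (⋃₀ D.region k m Q Q₀ j d \ ⋃₀ 𝒯)) ⊆ D.strips k m N j := by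
  rintro x ⟨hxV, hx⟩
  have hx1 : x ∉ innerCore (16 ^ (k - N)) (⋃₀ 𝒯) := fun h => hx (Or.inl h)
  by_cases hxY : x ∈ ⋃₀ 𝒯
  · exact D.sUnion_sdiff_innerCore_subset h𝒯 ⟨hxY, hx1⟩
  have hx2 : x ∈ thickening (16 ^ (k - N)) (⋃₀ D.region k m Q Q₀ j d \ ⋃₀ 𝒯)ᶜ :=
    not_not.1 fun h => hx (Or.inr h)
  obtain ⟨y, hy, hxy⟩ := mem_thickening_iff.1 hx2
  by_cases hyV : y ∈ ⋃₀ D.region k m Q Q₀ j d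
  · obtain ⟨S, hS, hyS⟩ : y ∈ ⋃₀ 𝒯 := not_not.1 fun h => hy ⟨hyV, h⟩
    obtain ⟨l, hl, hl', hlj, hSl, -⟩ := h𝒯 hS
    exact D.mem_strips hl hl' hlj hSl (mem_thickening_iff.2 ⟨y, hyS, hxy⟩)
      (self_subset_thickening (by positivity) _ fun h => hxY ⟨S, hS, h⟩)
  · obtain ⟨S, hS, hxS⟩ := hxV
    obtain ⟨l, hl, hl', hlj, hSl, -⟩ := id hS
    exact D.mem_strips hl hl' hlj hSl (self_subset_thickening (by positivity) _ hxS)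
      (mem_thickening_iff.2 ⟨y, fun h => hyV ⟨S, hS, h⟩, hxy⟩)

end CubeSystem

namespace CubeSystem

variable (D : CubeSystem X μ K n C RK a η₀) {k j l : ℤ} {Q Q' Q₀ R S T : Set X} {d : ℝ}

lemma subset_sUnion_region (hkj : k ≤ j) {m : ℕ} (hd : 0 < d) (hj : j ≤ D.kK)
    (hQ : Q ∈ D.cubes k) (hQ₀ : Q ⊆ Q₀) :
    Q ⊆ ⋃₀ D.region k m Q Q₀ j d := by
  obtain ⟨x, hx⟩ := D.nonempty (hkj.trans hj) hQ
  exact subset_sUnion_of_mem ⟨k, by omega, by omega, hkj, hQ, hQ₀, x, hx,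
    self_subset_thickening (by positivity) _ hx⟩

lemma dist_lt_of_mem_thickening (hk : k ≤ D.kK) (hQ : Q ∈ D.cubes k) {p q : X}
    (hp : p ∈ thickening (d * 16 ^ k) Q) (hq : q ∈ thickening (d * 16 ^ k) Q) :
    dist p q < (2 * d + 32) * 16 ^ k := by
  obtain ⟨u, hu, hpu⟩ := mem_thickening_iff.1 hp
  obtain ⟨v, hv, hqv⟩ := mem_thickening_iff.1 hq
  have h1 := D.dist_le hk hQ hu hv
  have h2 := dist_triangle p u q
  have h3 := dist_triangle_right u q v
  linarith

/-- The gain of a cube whose neighbourhood is mostly outside the strips. -/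
lemma gain_le [BorelSpace X] [IsFiniteMeasure μ] (hreg : RegularOn μ K n C RK)
    (hkj : k ≤ j) (hj : j ≤ D.kK) (hQ : Q ∈ D.cubes k)
    {h : Set X → ℝ} {M : ℝ} (hh : IsContent μ h M) {m N : ℕ} {ε κ : ℝ} (hε0 : 0 ≤ ε)
    (hκ : 0 ≤ κ) (hε : ε * (C ^ 2 * (256 * 16 ^ m) ^ n) ≤ 1 / 2)
    (hεκ : 2 * (M * (ε * (C ^ 2 * (256 * 16 ^ m) ^ n))) ≤ κ / 2)
    {𝒯 : Set (Set X)} (h𝒯 : 𝒯 ⊆ D.region k m Q Q₀ j d) (hne : 𝒯.Nonempty)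
    (hclean : μ.real (nbhd Q k Q₀ j (d + 32 * 16 ^ m) ∩ D.strips k m N j) ≤ ε * μ.real Q)
    (hgap : κ ≤ |h (⋃₀ 𝒯) / μ.real (⋃₀ 𝒯) -
      h (⋃₀ D.region k m Q Q₀ j d) / μ.real (⋃₀ D.region k m Q Q₀ j d)|)
    {A B : Set X} (hA : innerCore (16 ^ (k - N)) (⋃₀ 𝒯) ⊆ A) (hAY : A ⊆ ⋃₀ 𝒯)
    (hB : innerCore (16 ^ (k - N)) (⋃₀ D.region k m Q Q₀ j d \ ⋃₀ 𝒯) ⊆ B)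
    (hBV : B ⊆ ⋃₀ D.region k m Q Q₀ j d \ ⋃₀ 𝒯) :
    κ ^ 2 / 8 * ((C ^ 2 * (256 * 16 ^ m) ^ n)⁻¹ * μ.real Q) ≤
      μ.real A * (h A / μ.real A - h (A ∪ B) / μ.real (A ∪ B)) ^ 2 := by
  have hC := hreg.one_lt
  have hC1 : 0 < C ^ 2 * (256 * (16 : ℝ) ^ m) ^ n := by positivity
  set V := ⋃₀ D.region k m Q Q₀ j d with hV
  have hYV : ⋃₀ 𝒯 ⊆ V := sUnion_subset_sUnion h𝒯
  have hVn : V ⊆ nbhd Q k Q₀ j (d + 32 * 16 ^ m) := D.sUnion_region_subset hj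
  have hQY : μ.real Q ≤ C ^ 2 * (256 * 16 ^ m) ^ n * μ.real (⋃₀ 𝒯) := by
    obtain ⟨S, hS⟩ := hne
    obtain ⟨l, hl, hl', hlj, hSl, -⟩ := h𝒯 hS
    refine (D.measure_le_mul hreg (hkj.trans hj) (i := m) (by omega) (hlj.trans hj) hQ hSl).trans ?_
    gcongr
    · exact measure_ne_top _ _
    · exact subset_sUnion_of_mem hS
  have hY : 0 < μ.real (⋃₀ 𝒯) :=
    pos_of_mul_pos_right ((D.measure_pos hreg (hkj.trans hj) hQ).trans_le hQY) hC1.le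
  have hYVμ : μ.real (⋃₀ 𝒯) ≤ μ.real V := measureReal_mono hYV (measure_ne_top _ _)
  have hsmall : ∀ Z ⊆ V, Z ⊆ D.strips k m N j →
      μ.real Z ≤ ε * (C ^ 2 * (256 * 16 ^ m) ^ n) * μ.real (⋃₀ 𝒯) := fun Z hZV hZ => by
    calc μ.real Z ≤ ε * μ.real Q :=
          (measureReal_mono (subset_inter (hZV.trans hVn) hZ) (measure_ne_top _ _)).trans hclean
      _ ≤ ε * (C ^ 2 * (256 * 16 ^ m) ^ n * μ.real (⋃₀ 𝒯)) := by gcongr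
      _ = _ := by ring
  refine le_trans ?_ (hh.gain_le (ε := ε * (C ^ 2 * (256 * 16 ^ m) ^ n)) hY (hY.trans_le hYVμ)
    hAY (union_subset (hAY.trans hYV) (hBV.trans Set.sdiff_subset)) ?_ ?_ hε hκ hεκ hgap)
  · gcongr
    rwa [inv_mul_le_iff₀ hC1]
  · exact hsmall _ (Set.sdiff_subset.trans hYV) ((sdiff_subset_sdiff_right hA).trans
      (D.sUnion_sdiff_innerCore_subset h𝒯))
  · refine (hsmall _ Set.sdiff_subset ((sdiff_subset_sdiff_right (union_subset_union hA hB)).trans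
      (D.sUnion_sdiff_innerCores_subset h𝒯))).trans ?_
    gcongr

/-- The packing of cubes with gaps, for families with well separated generations. -/
lemma sum_le_of_gap_of_sep [BorelSpace X] [IsFiniteMeasure μ] (hreg : RegularOn μ K n C RK)
    (hj : j ≤ D.kK) (hQ₀ : Q₀ ∈ D.cubes j)
    {h : Set X → ℝ} {M : ℝ} (hh : IsContent μ h M) (hd : 0 < d) {m N q : ℕ}
    (hq : 2 * (d + 32 * 16 ^ m) + 32 ≤ (16 : ℝ) ^ q) {ε κ : ℝ} (hε0 : 0 ≤ ε)
    (hκ : 0 < κ) (hε : ε * (C ^ 2 * (256 * 16 ^ m) ^ n) ≤ 1 / 2)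
    (hεκ : 2 * (M * (ε * (C ^ 2 * (256 * 16 ^ m) ^ n))) ≤ κ / 2)
    (F : Finset (Set X)) (lev : Set X → ℤ) (hlev : ∀ Q ∈ F, lev Q ≤ j)
    (hF : ∀ Q ∈ F, Q ∈ D.cubes (lev Q)) (hF₀ : ∀ Q ∈ F, Q ⊆ Q₀)
    (hsep : ∀ Q ∈ F, ∀ Q' ∈ F, lev Q' < lev Q → lev Q' + (N + q : ℕ) ≤ lev Q)
    (𝒯 : Set X → Set (Set X)) (h𝒯 : ∀ Q ∈ F, 𝒯 Q ⊆ D.region (lev Q) m Q Q₀ j d)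
    (hne : ∀ Q ∈ F, (𝒯 Q).Nonempty)
    (hclean : ∀ Q ∈ F, μ.real (nbhd Q (lev Q) Q₀ j (d + 32 * 16 ^ m) ∩ D.strips (lev Q) m N j) ≤
      ε * μ.real Q)
    (hgap : ∀ Q ∈ F, κ ≤ |h (⋃₀ 𝒯 Q) / μ.real (⋃₀ 𝒯 Q) -
      h (⋃₀ D.region (lev Q) m Q Q₀ j d) / μ.real (⋃₀ D.region (lev Q) m Q Q₀ j d)|) :
    ∑ Q ∈ F, μ.real Q ≤
      C ^ 2 * 256 ^ n * (C ^ 2 * (16 * (2 * (d + 32 * 16 ^ m) + 32 + 16)) ^ n) *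
        (8 / κ ^ 2 * (C ^ 2 * (256 * 16 ^ m) ^ n)) * (M ^ 2 * (C ^ 2 * 512 ^ n)) *
          μ.real Q₀ := by
  classical
  have hC := hreg.one_lt
  have hC1 : 0 < C ^ 2 * (256 * (16 : ℝ) ^ m) ^ n := by positivity
  set d₁ := d + 32 * (16 : ℝ) ^ m with hd₁
  have hd₁0 : 0 < d₁ := by positivity
  set V : Set X → Set X := fun Q => ⋃₀ D.region (lev Q) m Q Q₀ j d with hV
  have hVn : ∀ Q, V Q ⊆ nbhd Q (lev Q) Q₀ j d₁ := fun Q => D.sUnion_region_subset hj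
  obtain ⟨I, hIF, hind, hdom⟩ := exists_independent_dominating
    (fun P Q => lev P = lev Q ∧ (V P ∩ V Q).Nonempty)
    (fun P Q hPQ => ⟨hPQ.1.symm, by rw [inter_comm]; exact hPQ.2⟩) F (fun Q hQ => ⟨rfl, by
      rw [inter_self]
      exact (D.nonempty ((hlev Q hQ).trans hj) (hF Q hQ)).mono
        (D.subset_sUnion_region (hlev Q hQ) hd hj (hF Q hQ) (hF₀ Q hQ))⟩)
  obtain ⟨𝓑, hdisj, hmeas, h𝓑V, hsum⟩ := hh.exists_blocks I lev V (fun Q => ⋃₀ 𝒯 Q)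
    (fun Q => 16 ^ (lev Q - N))
    (fun Q => κ ^ 2 / 8 * ((C ^ 2 * (256 * 16 ^ m) ^ n)⁻¹ * μ.real Q))
    (fun Q _ => by positivity) (fun Q hQ => sUnion_subset_sUnion (h𝒯 Q (hIF hQ)))
    (fun P hP Q hQ hPQ hle => by
      rcases hle.lt_or_eq with hlt | heq
      · refine Or.inr fun x hx y hy => ?_
        have h1 := D.dist_lt_of_mem_thickening ((hlev Q (hIF hQ)).trans hj) (hF Q (hIF hQ))
          (hVn Q hx).1 (hVn Q hy).1
        refine h1.trans_le ?_
        calc (2 * d₁ + 32) * (16 : ℝ) ^ lev Q ≤ 16 ^ q * 16 ^ lev Q := by gcongr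
          _ = 16 ^ (lev Q + q) := by rw [zpow_add₀ (by norm_num), zpow_natCast, mul_comm]
          _ ≤ 16 ^ (lev P - N) := by
            have h2 := hsep P (hIF hP) Q (hIF hQ) hlt
            push_cast at h2
            exact zpow_le_zpow_right₀ (by norm_num) (by omega)
      · refine Or.inl (disjoint_iff_inter_eq_empty.2 (not_nonempty_iff_eq_empty.1 fun hne' => ?_))
        exact hind P hP Q hQ hPQ ⟨heq.symm, hne'⟩)
    (fun Q hQ A B _ _ hA hAY hB hBV => D.gain_le hreg (hlev Q (hIF hQ)) hj (hF Q (hIF hQ)) hh hε0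
      hκ.le hε hεκ (h𝒯 Q (hIF hQ)) (hne Q (hIF hQ)) (hclean Q (hIF hQ)) (hgap Q (hIF hQ))
      hA hAY hB hBV)
  have hI : ∑ Q ∈ I, μ.real Q ≤
      8 / κ ^ 2 * (C ^ 2 * (256 * 16 ^ m) ^ n) * (M ^ 2 * (C ^ 2 * 512 ^ n * μ.real Q₀)) := by
    have h1 := hh.sum_defect_le 𝓑 hmeas hdisj
      (isOpen_thickening (δ := 16 * 16 ^ j) (E := Q₀)).measurableSet fun B hB => by
        obtain ⟨Q, -, hBQ⟩ := h𝓑V B hB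
        exact hBQ.trans ((hVn Q).trans inter_subset_right)
    have h2 := (hsum.trans h1).trans (defect_le _ _ _ _)
    have h3 := h2.trans
      (mul_le_mul_of_nonneg_left (D.measure_thickening_self_le hreg hj hQ₀) (sq_nonneg M))
    rw [← Finset.mul_sum, ← Finset.mul_sum] at h3
    calc ∑ Q ∈ I, μ.real Q = 8 / κ ^ 2 * (C ^ 2 * (256 * 16 ^ m) ^ n) *
          (κ ^ 2 / 8 * ((C ^ 2 * (256 * 16 ^ m) ^ n)⁻¹ * ∑ Q ∈ I, μ.real Q)) := by
            field_simp
      _ ≤ _ := by gcongr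
  calc ∑ Q ∈ F, μ.real Q
      ≤ ∑ Q ∈ F, ∑ P ∈ I with lev Q = lev P ∧ (V Q ∩ V P).Nonempty, μ.real Q := by
        refine Finset.sum_le_sum fun Q hQ => ?_
        obtain ⟨P, hP, hPQ⟩ := hdom Q hQ
        exact Finset.single_le_sum (f := fun _ => μ.real Q) (fun _ _ => measureReal_nonneg)
          (Finset.mem_filter.2 ⟨hP, hPQ⟩)
    _ = ∑ P ∈ I, ∑ Q ∈ F with lev Q = lev P ∧ (V Q ∩ V P).Nonempty, μ.real Q := by
        simp_rw [Finset.sum_filter]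
        exact Finset.sum_comm
    _ ≤ ∑ P ∈ I, C ^ 2 * 256 ^ n * (C ^ 2 * (16 * (2 * d₁ + 32 + 16)) ^ n * μ.real P) := by
        refine Finset.sum_le_sum fun P hP => ?_
        have hPj := hlev P (hIF hP)
        refine (D.sum_measure_le hreg (hPj.trans hj) _ (E := thickening ((2 * d₁ + 32) * 16 ^ lev P)
          P ∩ thickening (128 * 16 ^ j) Q₀) (fun Q hQ => ?_) fun Q hQ => ?_).trans ?_
        · obtain ⟨hQF, heq, -⟩ := Finset.mem_filter.1 hQ
          exact heq ▸ hF Q hQF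
        · obtain ⟨hQF, heq, x, hxQ, hxP⟩ := Finset.mem_filter.1 hQ
          have hxQ' := (hVn Q hxQ).1
          rw [heq] at hxQ'
          exact subset_inter (D.thickening_subset_of_mem (hPj.trans hj) (heq ▸ hF Q hQF)
            (hVn P hxP).1 hxQ')
            ((hF₀ Q hQF).trans (self_subset_thickening (by positivity) _))
        · gcongr
          exact D.measure_thickening_le_mul hreg hPj hj (hF P (hIF hP)) hQ₀ (by positivity)
    _ ≤ _ := by
        rw [← Finset.mul_sum, ← Finset.mul_sum]
        calc _ ≤ C ^ 2 * 256 ^ n * (C ^ 2 * (16 * (2 * d₁ + 32 + 16)) ^ n *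
              (8 / κ ^ 2 * (C ^ 2 * (256 * 16 ^ m) ^ n) *
                (M ^ 2 * (C ^ 2 * 512 ^ n * μ.real Q₀)))) := by gcongr
          _ = _ := by ring

/-- The packing of cubes with gaps. -/
lemma sum_le_of_gap [BorelSpace X] [IsFiniteMeasure μ] (hreg : RegularOn μ K n C RK)
    (hj : j ≤ D.kK) (hQ₀ : Q₀ ∈ D.cubes j)
    {h : Set X → ℝ} {M : ℝ} (hh : IsContent μ h M) (hd : 0 < d) {m N q : ℕ}
    (hq : 2 * (d + 32 * 16 ^ m) + 32 ≤ (16 : ℝ) ^ q) {ε κ : ℝ} (hε0 : 0 ≤ ε)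
    (hκ : 0 < κ) (hε : ε * (C ^ 2 * (256 * 16 ^ m) ^ n) ≤ 1 / 2)
    (hεκ : 2 * (M * (ε * (C ^ 2 * (256 * 16 ^ m) ^ n))) ≤ κ / 2)
    (F : Finset (Set X)) (lev : Set X → ℤ) (hlev : ∀ Q ∈ F, lev Q ≤ j)
    (hF : ∀ Q ∈ F, Q ∈ D.cubes (lev Q)) (hF₀ : ∀ Q ∈ F, Q ⊆ Q₀)
    (𝒯 : Set X → Set (Set X)) (h𝒯 : ∀ Q ∈ F, 𝒯 Q ⊆ D.region (lev Q) m Q Q₀ j d)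
    (hne : ∀ Q ∈ F, (𝒯 Q).Nonempty)
    (hclean : ∀ Q ∈ F, μ.real (nbhd Q (lev Q) Q₀ j (d + 32 * 16 ^ m) ∩ D.strips (lev Q) m N j) ≤
      ε * μ.real Q)
    (hgap : ∀ Q ∈ F, κ ≤ |h (⋃₀ 𝒯 Q) / μ.real (⋃₀ 𝒯 Q) -
      h (⋃₀ D.region (lev Q) m Q Q₀ j d) / μ.real (⋃₀ D.region (lev Q) m Q Q₀ j d)|) :
    ∑ Q ∈ F, μ.real Q ≤ (N + q : ℕ) *
      (C ^ 2 * 256 ^ n * (C ^ 2 * (16 * (2 * (d + 32 * 16 ^ m) + 32 + 16)) ^ n) *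
        (8 / κ ^ 2 * (C ^ 2 * (256 * 16 ^ m) ^ n)) * (M ^ 2 * (C ^ 2 * 512 ^ n))) *
          μ.real Q₀ := by
  classical
  have hNq : 0 < N + q := by
    rcases Nat.eq_zero_or_pos q with rfl | h0
    · rw [pow_zero] at hq
      have : (0 : ℝ) < 16 ^ m := by positivity
      linarith
    · omega
  rw [← Finset.sum_fiberwise_of_maps_to (s := F) (t := Finset.range (N + q))
    (g := fun Q => (lev Q % (N + q : ℕ)).toNat) fun Q _ => by
      have h1 := Int.emod_lt_of_pos (lev Q) (b := (N + q : ℕ)) (by omega)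
      have h2 := Int.emod_nonneg (lev Q) (b := (N + q : ℕ)) (by omega)
      rw [Finset.mem_range]
      omega]
  refine (Finset.sum_le_card_nsmul _ _ _ fun e _ => ?_).trans_eq
    (by rw [Finset.card_range, nsmul_eq_mul, mul_assoc])
  refine D.sum_le_of_gap_of_sep hreg hj hQ₀ hh hd hq hε0 hκ hε hεκ _ lev
    (fun Q hQ => hlev Q (Finset.mem_filter.1 hQ).1) (fun Q hQ => hF Q (Finset.mem_filter.1 hQ).1)
    (fun Q hQ => hF₀ Q (Finset.mem_filter.1 hQ).1) (fun P hP Q hQ hlt => ?_) 𝒯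
    (fun Q hQ => h𝒯 Q (Finset.mem_filter.1 hQ).1) (fun Q hQ => hne Q (Finset.mem_filter.1 hQ).1)
    (fun Q hQ => hclean Q (Finset.mem_filter.1 hQ).1)
    (fun Q hQ => hgap Q (Finset.mem_filter.1 hQ).1)
  have h1 := (Finset.mem_filter.1 hP).2
  have h2 := (Finset.mem_filter.1 hQ).2
  have h3 := Int.emod_nonneg (lev P) (b := (N + q : ℕ)) (by omega)
  have h4 := Int.emod_nonneg (lev Q) (b := (N + q : ℕ)) (by omega)
  have h5 : lev P % (N + q : ℕ) = lev Q % (N + q : ℕ) := by omega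
  have h6 : ((N + q : ℕ) : ℤ) ∣ lev P - lev Q := Int.ModEq.dvd h5.symm
  have h7 := Int.le_of_dvd (by omega) h6
  omega

end CubeSystem

/-- The ratio of image to mass, as a real number. -/
lemma RegularOn.hausdorffMeasure_image_div [BorelSpace X] [TopologicalSpace.SeparableSpace X]
    [IsFiniteMeasure μ] (hreg : RegularOn μ K n C RK) (hRK : 0 < RK)
    {φ : X → EuclideanSpace ℝ (Fin n)} (hφ : LipschitzWith 1 φ) {B : Set X} (hB : 0 < μ.real B) :
    μH[n] (φ '' (B ∩ K)) / μ B = ENNReal.ofReal (imageContent K φ B / μ.real B) := by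
  rw [ENNReal.ofReal_div_of_pos hB, imageContent, measureReal_def, measureReal_def,
    ENNReal.ofReal_toReal (hreg.hausdorffMeasure_image_ne_top hRK hφ B),
    ENNReal.ofReal_toReal (measure_ne_top μ B)]

/-- Two ratios that differ little, relatively to a lower bound, are comparable. -/
lemma ratio_bounds_of_abs_sub_le {ζ δ x y : ℝ} (hζ : 0 < ζ) (hx : δ ≤ x) (hδ : 0 < δ)
    (hxy : |y - x| ≤ δ * ζ / (1 + ζ)) :
    (ENNReal.ofReal (1 + ζ))⁻¹ * ENNReal.ofReal x ≤ ENNReal.ofReal y ∧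
      ENNReal.ofReal y ≤ ENNReal.ofReal (1 + ζ) * ENNReal.ofReal x := by
  have h1 : 0 < 1 + ζ := by linarith
  have h2 : δ * ζ / (1 + ζ) ≤ x * ζ / (1 + ζ) := by gcongr
  have h3 : x * ζ / (1 + ζ) ≤ x * ζ := div_le_self (by nlinarith) (by linarith)
  have h4 : (1 + ζ)⁻¹ * x = x - x * ζ / (1 + ζ) := by field_simp; ring
  obtain ⟨h5, h6⟩ := abs_le.1 hxy
  rw [← ENNReal.ofReal_inv_of_pos h1, ← ENNReal.ofReal_mul (by positivity),
    ← ENNReal.ofReal_mul h1.le]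
  exact ⟨ENNReal.ofReal_le_ofReal (by linarith), ENNReal.ofReal_le_ofReal (by linarith)⟩

namespace CubeSystem

variable (D : CubeSystem X μ K n C RK a η₀) {k j l : ℤ} {Q Q' Q₀ R S T : Set X} {d : ℝ}

lemma le_of_subset (hj : lvl D Q₀ = j) (hQ₀ : Q₀ ∈ D.cubes j) (hk : k ≤ D.kK)
    (hQ : Q ∈ D.cubes k) (hQQ₀ : Q ⊆ Q₀) : k ≤ j := by
  by_contra! h
  obtain ⟨x, hx⟩ := D.nonempty hk hQ
  have h1 := D.subset_of_mem h.le hk hQ₀ hQ (hQQ₀ hx) hx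
  have h2 := D.le_lvl hk (hQQ₀.antisymm h1 ▸ hQ)
  omega

lemma eq_of_aNeighbor_of_diam_eq_zero {A : ℝ} (hQ : IsCube D Q) (hR : IsCube D R)
    (hd : diam Q = 0) (h : ANeighbor A Q R) : R = Q := by
  obtain ⟨k, hk, hQ⟩ := hQ
  obtain ⟨r, hr, hR⟩ := hR
  obtain ⟨h1, -, h2⟩ := h
  rw [hd, mul_zero] at h2
  have hdR : diam R = 0 := le_antisymm h2 diam_nonneg
  rw [hd, hdR, add_zero, mul_zero] at h1
  obtain ⟨x, hx, y, hy, hxy⟩ := exists_dist_lt_of_setDist_lt (D.nonempty hk hQ)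
    (D.nonempty hr hR) (h1.trans_lt (show (0 : ℝ) < 16 ^ r / 16 by positivity))
  have hR1 : ∀ p ∈ R, ∀ q ∈ R, p = q := fun p hp q hq => dist_le_zero.1
    ((dist_le_diam_of_mem (D.isBounded hr hR) hp hq).trans hdR.le)
  have hQ1 : ∀ p ∈ Q, ∀ q ∈ Q, p = q := fun p hp q hq => dist_le_zero.1
    ((dist_le_diam_of_mem (D.isBounded hk hQ) hp hq).trans hd.le)
  obtain ⟨z, -, hz, -⟩ := D.exists_center hr hR
  have hxR : x ∈ R := hz (by
    rw [hR1 z (hz (mem_closedBall_self (by positivity))) y hy]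
    exact mem_closedBall.2 hxy.le)
  ext p
  exact ⟨fun hp => hR1 x hxR p hp ▸ hx, fun hp => hQ1 x hx p hp ▸ hxR⟩

lemma hat_eq_of_diam_eq_zero (hQ : IsCube D Q) (hd : diam Q = 0) (hQ₀ : Q ⊆ Q₀) :
    hat D Q₀ Q = Q := by
  obtain ⟨hk, hQk⟩ := D.lvl_spec hQ
  refine Subset.antisymm ?_ (subset_inter (subset_sUnion_of_mem ⟨hQk, ?_⟩) hQ₀)
  · rintro x ⟨⟨S, ⟨hS, hSQ⟩, hx⟩, -⟩
    rwa [← D.eq_of_setDist_le hk hQk hS (by rw [hd]; positivity) hSQ]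
  · exact (setDist_self (D.nonempty hk hQk)).trans diam_nonneg

lemma mem_MAset_of_diam_eq_zero {φ : X → EuclideanSpace ℝ (Fin n)} {A δ ζ : ℝ}
    (hδ : 0 < δ) (hζ : 0 < ζ) (hQ : IsCube D Q) (hQ₀ : Q ⊆ Q₀) (hd : diam Q = 0)
    (hθ : ENNReal.ofReal δ * μ Q ≤ μH[n] (φ '' (Q ∩ K))) : Q ∈ MAset D φ δ ζ A Q₀ := by
  have h1 : (1 + ζ)⁻¹ * δ ≤ δ :=
    mul_le_of_le_one_left hδ.le (inv_le_one_of_one_le₀ (by linarith))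
  have h2 : ∀ x : ℝ≥0∞, (ENNReal.ofReal (1 + ζ))⁻¹ * x ≤ x ∧ x ≤ ENNReal.ofReal (1 + ζ) * x := by
    intro x
    have h3 : 1 ≤ ENNReal.ofReal (1 + ζ) := by rw [ENNReal.one_le_ofReal]; linarith
    exact ⟨mul_le_of_le_one_left' (ENNReal.inv_le_one.2 h3), le_mul_of_one_le_left' h3⟩
  refine ⟨hQ, hQ₀, le_trans (by gcongr) hθ, fun R hR hQR => ?_, fun R hR hQR => ?_⟩ <;>
    rw [D.eq_of_aNeighbor_of_diam_eq_zero hQ hR hd hQR]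
  · exact ⟨hQ₀, h2 _⟩
  · rw [D.hat_eq_of_diam_eq_zero hQ hd hQ₀]
    exact h2 _

section Dichotomy

variable [BorelSpace X] [TopologicalSpace.SeparableSpace X] [IsFiniteMeasure μ]
  {φ : X → EuclideanSpace ℝ (Fin n)} {A δ ζ : ℝ} {m : ℕ}

/-- The neighbours of a cube that is not in the boundary layer of `Q₀`, and their hulls, are unions
of cubes in the region of the cube. -/
lemma exists_families_of_aNeighbor (hreg : RegularOn μ K n C RK) (hRK : 0 < RK) (hA : 1 < A)
    (hm : 32 * A * (C ^ 2 * 256) ≤ 16 ^ m) (hj : lvl D Q₀ = j) (hj' : j ≤ D.kK)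
    (hQ₀ : Q₀ ∈ D.cubes j) (hk : k ≤ D.kK) (hQ : Q ∈ D.cubes k) (hQQ₀ : Q ⊆ Q₀) (hd : 0 < diam Q)
    (hdk : (C ^ 2 * 256)⁻¹ * (16 : ℝ) ^ k ≤ diam Q)
    (hbd : Q ∉ D.boundaryCubes Q₀ k (64 * A ^ 2 + 64 * A + 2))
    (hR : IsCube D R) (hQR : ANeighbor A Q R) :
    R ⊆ Q₀ ∧ R ∈ D.region k m Q Q₀ j (64 * A ^ 2 + 64 * A + 2) ∧
      ∃ 𝒯 ⊆ D.region k m Q Q₀ j (64 * A ^ 2 + 64 * A + 2), R ∈ 𝒯 ∧ hat D Q₀ R = ⋃₀ 𝒯 := by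
  have hC := hreg.one_lt
  have h16 : (0 : ℝ) < 16 ^ k := by positivity
  have hQd := D.diam_le hk hQ
  obtain ⟨hdist, hlow, hup⟩ := hQR
  rw [inv_mul_le_iff₀ (by linarith)] at hlow
  have hdR : 0 < diam R := pos_of_mul_pos_right (hd.trans_le hlow) (by linarith)
  have hupk : diam R ≤ 32 * A * 16 ^ k := by nlinarith
  obtain ⟨r, hr, hRr, hdr, hhat⟩ := D.exists_scale hreg hRK hR hdR
  have hscale : ∀ {s t : ℤ}, (C ^ 2 * 256)⁻¹ * (16 : ℝ) ^ s ≤ 32 * A * 16 ^ t → s ≤ t + m := by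
    intro s t hst
    rw [inv_mul_le_iff₀ (by positivity)] at hst
    have h1 : (16 : ℝ) ^ s ≤ 16 ^ (t + m) := by
      rw [zpow_add₀ (by norm_num), zpow_natCast]
      calc (16 : ℝ) ^ s ≤ 16 ^ t * (32 * A * (C ^ 2 * 256)) := by linarith
        _ ≤ _ := by gcongr
    exact (zpow_le_zpow_iff_right₀ (by norm_num)).1 h1
  have hrk : r ≤ k + m := hscale (hdr.trans hupk)
  have hkr : k ≤ r + m := hscale (by
    have := D.diam_le hr hRr
    nlinarith)
  obtain ⟨x, hx, y, hy, hxy⟩ := exists_dist_lt_of_setDist_lt (D.nonempty hk hQ)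
    (D.nonempty hr hRr) (r := (64 * A ^ 2 + 1) * 16 ^ k) (hdist.trans_lt (by
      have h1 : A * (diam Q + diam R) ≤ A * (32 * 16 ^ k + 32 * A * 16 ^ k) := by gcongr
      have h2 : A * (32 * 16 ^ k + 32 * A * 16 ^ k) ≤ 64 * A ^ 2 * 16 ^ k := by nlinarith
      linarith))
  have hclose : ∀ y' ∈ R, dist x y' < (64 * A ^ 2 + 32 * A + 1) * 16 ^ k := fun y' hy' => by
    have h1 := dist_le_diam_of_mem (D.isBounded hr hRr) hy hy'
    linarith [dist_triangle x y y']
  have hRQ₀ : R ⊆ Q₀ := by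
    intro y' hy'
    by_contra hn
    exact hbd ⟨hQ, hQQ₀, x, hx, y', hn, (hclose y' hy').trans (by nlinarith)⟩
  have hrj : r ≤ j := D.le_of_subset hj hQ₀ hr hRr hRQ₀
  have hRreg : R ∈ D.region k m Q Q₀ j (64 * A ^ 2 + 64 * A + 2) :=
    ⟨r, by omega, hrk, hrj, hRr, hRQ₀, y, hy, mem_thickening_iff.2 ⟨x, hx, by
      rw [dist_comm]
      exact (hclose y hy).trans (by nlinarith)⟩⟩
  refine ⟨hRQ₀, hRreg, ?_⟩
  obtain ⟨𝒯, h𝒯, hR𝒯, hhatR, h𝒯d⟩ := hhat Q₀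
  refine ⟨{S | S ∈ 𝒯 ∧ S ⊆ Q₀}, ?_, ⟨hR𝒯, hRQ₀⟩, ?_⟩
  · rintro S ⟨hS, hSQ₀⟩
    obtain ⟨s, hs, y', hy', hsy⟩ := exists_dist_lt_of_setDist_lt (D.nonempty hr (h𝒯 hS))
      (D.nonempty hr hRr) (r := (32 * A + 1) * 16 ^ k) ((h𝒯d S hS).trans_lt (by linarith))
    refine ⟨r, by omega, hrk, hrj, h𝒯 hS, hSQ₀, s, hs, mem_thickening_iff.2 ⟨x, hx, ?_⟩⟩
    have h1 := hclose y' hy'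
    have h2 := dist_triangle_right s x y'
    linarith
  · rw [hhatR]
    ext p
    constructor
    · rintro ⟨⟨S, hS, hpS⟩, hp⟩
      exact ⟨S, ⟨hS, D.subset_of_mem hrj hj' (h𝒯 hS) hQ₀ hpS hp⟩, hpS⟩
    · rintro ⟨S, ⟨hS, hSQ₀⟩, hpS⟩
      exact ⟨⟨S, hS, hpS⟩, hSQ₀ hpS⟩

/-- A cube outside `M_A` and `SI` is in the boundary layer of `Q₀` or has a gap in its region. -/
lemma boundary_or_gap_of_notMem (hreg : RegularOn μ K n C RK) (hRK : 0 < RK)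
    (hφ : LipschitzWith 1 φ) (hA : 1 < A) (hδ : 0 < δ) (hζ : 0 < ζ)
    (hm : 32 * A * (C ^ 2 * 256) ≤ 16 ^ m) (hj : lvl D Q₀ = j) (hj' : j ≤ D.kK)
    (hQ₀ : Q₀ ∈ D.cubes j) (hQ : IsCube D Q) (hQQ₀ : Q ⊆ Q₀) (hMA : Q ∉ MAset D φ δ ζ A Q₀)
    (hSI : Q ∉ SIset D φ δ Q₀) :
    ∃ k ≤ j, Q ∈ D.cubes k ∧ (Q ∈ D.boundaryCubes Q₀ k (64 * A ^ 2 + 64 * A + 2) ∨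
      ∃ 𝒯 ⊆ D.region k m Q Q₀ j (64 * A ^ 2 + 64 * A + 2), 𝒯.Nonempty ∧
        δ * ζ / (1 + ζ) / 2 ≤ |imageContent K φ (⋃₀ 𝒯) / μ.real (⋃₀ 𝒯) -
          imageContent K φ (⋃₀ D.region k m Q Q₀ j (64 * A ^ 2 + 64 * A + 2)) /
            μ.real (⋃₀ D.region k m Q Q₀ j (64 * A ^ 2 + 64 * A + 2))|) := by
  have hC := hreg.one_lt
  have hθ : ENNReal.ofReal δ * μ Q ≤ μH[n] (φ '' (Q ∩ K)) := by
    by_contra! h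
    exact hSI ⟨hQ, hQQ₀, Q, hQ, hQQ₀, Subset.rfl, h⟩
  have hd : 0 < diam Q := by
    refine diam_nonneg.lt_of_ne' fun h => hMA ?_
    exact D.mem_MAset_of_diam_eq_zero hδ hζ hQ hQQ₀ h hθ
  obtain ⟨k, hk, hQk, hdk, -⟩ := D.exists_scale hreg hRK hQ hd
  have hkj := D.le_of_subset hj hQ₀ hk hQk hQQ₀
  refine ⟨k, hkj, hQk, ?_⟩
  by_contra! hcon
  obtain ⟨hbd, hgap⟩ := hcon
  set d := 64 * A ^ 2 + 64 * A + 2 with hd_def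
  have hQpos := D.measure_pos hreg hk hQk
  have hθ' : δ ≤ imageContent K φ Q / μ.real Q := by
    rw [le_div_iff₀ hQpos]
    have h1 := ENNReal.toReal_mono (hreg.hausdorffMeasure_image_ne_top hRK hφ Q) hθ
    rwa [ENNReal.toReal_mul, ENNReal.toReal_ofReal hδ.le] at h1
  have hQreg : {Q} ⊆ D.region k m Q Q₀ j d := by
    rw [singleton_subset_iff]
    obtain ⟨x, hx⟩ := D.nonempty hk hQk
    exact ⟨k, by omega, by omega, hkj, hQk, hQQ₀, x, hx,
      self_subset_thickening (by positivity) _ hx⟩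
  have hgapQ := hgap {Q} hQreg (singleton_nonempty Q)
  rw [sUnion_singleton] at hgapQ
  have hcomp : ∀ 𝒯 ⊆ D.region k m Q Q₀ j d, ∀ R ∈ 𝒯, IsCube D R →
      (ENNReal.ofReal (1 + ζ))⁻¹ * (μH[n] (φ '' (Q ∩ K)) / μ Q) ≤
        μH[n] (φ '' (⋃₀ 𝒯 ∩ K)) / μ (⋃₀ 𝒯) ∧
      μH[n] (φ '' (⋃₀ 𝒯 ∩ K)) / μ (⋃₀ 𝒯) ≤
        ENNReal.ofReal (1 + ζ) * (μH[n] (φ '' (Q ∩ K)) / μ Q) := by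
    intro 𝒯 h𝒯 R hR hRc
    obtain ⟨r, hr, hRr⟩ := hRc
    have hpos : 0 < μ.real (⋃₀ 𝒯) := (D.measure_pos hreg hr hRr).trans_le
      (measureReal_mono (subset_sUnion_of_mem hR) (measure_ne_top _ _))
    rw [hreg.hausdorffMeasure_image_div hRK hφ hpos, hreg.hausdorffMeasure_image_div hRK hφ hQpos]
    refine ratio_bounds_of_abs_sub_le hζ hθ' hδ ?_
    have h1 := (abs_lt.1 (hgap 𝒯 h𝒯 ⟨R, hR⟩))
    have h2 := (abs_lt.1 hgapQ)
    exact abs_le.2 ⟨by linarith, by linarith⟩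
  refine hMA ⟨hQ, hQQ₀, le_trans ?_ hθ, fun R hR hQR => ?_, fun R hR hQR => ?_⟩
  · gcongr
    exact mul_le_of_le_one_left hδ.le (inv_le_one_of_one_le₀ (by linarith))
  · obtain ⟨h1, h2, -⟩ := D.exists_families_of_aNeighbor hreg hRK hA hm hj hj' hQ₀ hk hQk hQQ₀ hd
      hdk hbd hR hQR
    have h3 := hcomp {R} (singleton_subset_iff.2 h2) R rfl hR
    rw [sUnion_singleton] at h3
    exact ⟨h1, h3⟩
  · obtain ⟨-, -, 𝒯, h𝒯, hR𝒯, hhat⟩ := D.exists_families_of_aNeighbor hreg hRK hA hm hj hj' hQ₀ hk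
      hQk hQQ₀ hd hdk hbd hR hQR
    rw [hhat]
    exact hcomp 𝒯 h𝒯 R hR𝒯 hR

end Dichotomy

end CubeSystem

lemma tsum_measure_inter_le [IsFiniteMeasure μ] {𝒬 : Set (Set X)} {Q₀ : Set X} {c : ℝ}
    (hc : 0 ≤ c) (h : ∀ F : Finset (Set X), (∀ Q ∈ F, Q ∈ 𝒬) →
      ∑ Q ∈ F, μ.real Q ≤ c * μ.real Q₀) :
    ∑' Q : ↥𝒬, μ ((Q : Set X) ∩ K) ≤ ENNReal.ofReal c * μ Q₀ := by
  rw [ENNReal.tsum_eq_iSup_sum]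
  refine iSup_le fun s => ?_
  have h1 := h (s.map (Function.Embedding.subtype _)) fun Q hQ => by
    obtain ⟨P, -, rfl⟩ := Finset.mem_map.1 hQ
    exact P.2
  rw [Finset.sum_map] at h1
  calc ∑ Q ∈ s, μ ((Q : Set X) ∩ K) ≤ ∑ Q ∈ s, μ (Q : Set X) :=
        Finset.sum_le_sum fun Q _ => measure_mono inter_subset_left
    _ = ENNReal.ofReal (∑ Q ∈ s, μ.real (Q : Set X)) := by
        rw [ENNReal.ofReal_sum_of_nonneg fun _ _ => measureReal_nonneg]
        exact Finset.sum_congr rfl fun Q _ => (ofReal_measureReal).symm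
    _ ≤ ENNReal.ofReal (c * μ.real Q₀) := ENNReal.ofReal_le_ofReal h1
    _ = _ := by rw [ENNReal.ofReal_mul hc, ofReal_measureReal]

lemma RegularOn.of_ennreal [IsFiniteMeasure μ] (hC : 1 < C)
    (h : ∀ x ∈ K, ∀ r : ℝ, 0 < r → r < RK →
      ENNReal.ofReal (C⁻¹ * r ^ n) ≤ μ (closedBall x r) ∧
        μ (closedBall x r) ≤ ENNReal.ofReal (C * r ^ n)) : RegularOn μ K n C RK where
  one_lt := hC
  lower x hx r hr hr' :=
    (ENNReal.ofReal_le_iff_le_toReal (measure_ne_top _ _)).1 (h x hx r hr hr').1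
  upper x hx r hr hr' := ENNReal.toReal_le_of_le_ofReal (by positivity) (h x hx r hr hr').2

/-- The packing of cubes outside `M_A` and `SI`, with an explicit constant. -/
lemma CubeSystem.sum_le_of_notMem [BorelSpace X] [TopologicalSpace.SeparableSpace X]
    [IsFiniteMeasure μ] (D : CubeSystem X μ K n C RK a η₀) (hreg : RegularOn μ K n C RK)
    (hRK : 0 < RK) {φ : X → EuclideanSpace ℝ (Fin n)} (hφ : LipschitzWith 1 φ) {A δ ζ : ℝ}
    (hA : 1 < A) (hδ : 0 < δ) (hζ : 0 < ζ) {Q₀ : Set X} (hQ₀ : IsCube D Q₀)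
    {d d₁ κ ε : ℝ} {m i p q : ℕ} (hd : d = 64 * A ^ 2 + 64 * A + 2) (hd₁ : d₁ = d + 32 * 16 ^ m)
    (hκ : κ = δ * ζ / (1 + ζ) / 2) (hm : 32 * A * (C ^ 2 * 256) ≤ 16 ^ m)
    (hi : d + 32 ≤ 16 ^ i) (hq : 2 * d₁ + 32 ≤ 16 ^ q) (hε0 : 0 < ε)
    (hε : ε * (C ^ 2 * (256 * 16 ^ m) ^ n) ≤ 1 / 2)
    (hεκ : 2 * (10 ^ n * C * (ε * (C ^ 2 * (256 * 16 ^ m) ^ n))) ≤ κ / 2)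
    (hp : (2 * m + 1 : ℕ) * (C ^ 8 * (16 * (1 + 16) * 256 * 256 *
      (16 * (d₁ + 1 + 32 * 16 ^ m + 16))) ^ n * (1 - (C ^ 2 * 4096 ^ n)⁻¹) ^ p) ≤ ε / 2)
    (F : Finset (Set X)) (hF : ∀ Q ∈ F, IsCube D Q ∧ Q ⊆ Q₀ ∧ Q ∉ MAset D φ δ ζ A Q₀ ∧
      Q ∉ SIset D φ δ Q₀) :
    ∑ Q ∈ F, μ.real Q ≤
      (C ^ 2 * 256 ^ n * ((C ^ 2 * 4096 ^ n) * (i + 2 : ℕ)) +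
        2 / ε * (C ^ 2 * (16 * (2 * d₁ + 32 + 16)) ^ n *
          ((m + (m + p * 4) : ℕ) * (C ^ 2 * 512 ^ n))) +
        (m + p * 4 + q : ℕ) * (C ^ 2 * 256 ^ n * (C ^ 2 * (16 * (2 * d₁ + 32 + 16)) ^ n) *
          (8 / κ ^ 2 * (C ^ 2 * (256 * 16 ^ m) ^ n)) * ((10 ^ n * C) ^ 2 * (C ^ 2 * 512 ^ n)))) *
        μ.real Q₀ := by
  classical
  obtain ⟨hj, hQj⟩ := D.lvl_spec hQ₀
  have hd0 : 0 < d := by rw [hd]; positivity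
  have hd₁0 : 0 < d₁ := by rw [hd₁]; positivity
  have hκ0 : 0 < κ := by rw [hκ]; positivity
  have hdich : ∀ Q ∈ F, ∃ k ≤ lvl D Q₀, Q ∈ D.cubes k ∧ (Q ∈ D.boundaryCubes Q₀ k d ∨
      ∃ 𝒯 ⊆ D.region k m Q Q₀ (lvl D Q₀) d, 𝒯.Nonempty ∧
        κ ≤ |imageContent K φ (⋃₀ 𝒯) / μ.real (⋃₀ 𝒯) -
          imageContent K φ (⋃₀ D.region k m Q Q₀ (lvl D Q₀) d) /
            μ.real (⋃₀ D.region k m Q Q₀ (lvl D Q₀) d)|) := fun Q hQ => by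
    obtain ⟨h1, h2, h3, h4⟩ := hF Q hQ
    rw [hd, hκ]
    exact D.boundary_or_gap_of_notMem hreg hRK hφ hA hδ hζ hm rfl hj hQj h1 h2 h3 h4
  choose! lev hlev hcube hgap using hdich
  set F₁ := F.filter fun Q => Q ∈ D.boundaryCubes Q₀ (lev Q) d with hF₁
  set G := F.filter fun Q => Q ∉ D.boundaryCubes Q₀ (lev Q) d with hG
  set F₂ := G.filter fun Q => ε * μ.real Q < μ.real (nbhd Q (lev Q) Q₀ (lvl D Q₀) d₁ ∩
    D.strips (lev Q) m (m + p * 4) (lvl D Q₀)) with hF₂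
  set F₃ := G.filter fun Q => ¬ ε * μ.real Q < μ.real (nbhd Q (lev Q) Q₀ (lvl D Q₀) d₁ ∩
    D.strips (lev Q) m (m + p * 4) (lvl D Q₀)) with hF₃
  have hGF : ∀ Q ∈ G, Q ∈ F := fun Q hQ => (Finset.mem_filter.1 hQ).1
  have hF₂F : ∀ Q ∈ F₂, Q ∈ F := fun Q hQ => hGF Q (Finset.mem_filter.1 hQ).1
  have hF₃G : ∀ Q ∈ F₃, Q ∈ G := fun Q hQ => (Finset.mem_filter.1 hQ).1
  have hsplit : ∑ Q ∈ F, μ.real Q =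
      ∑ Q ∈ F₁, μ.real Q + ∑ Q ∈ F₂, μ.real Q + ∑ Q ∈ F₃, μ.real Q := by
    rw [add_assoc, hF₂, hF₃, Finset.sum_filter_add_sum_filter_not,
      Finset.sum_filter_add_sum_filter_not]
  have hgapG : ∀ Q ∈ G, ∃ 𝒯 ⊆ D.region (lev Q) m Q Q₀ (lvl D Q₀) d, 𝒯.Nonempty ∧
      κ ≤ |imageContent K φ (⋃₀ 𝒯) / μ.real (⋃₀ 𝒯) -
        imageContent K φ (⋃₀ D.region (lev Q) m Q Q₀ (lvl D Q₀) d) /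
          μ.real (⋃₀ D.region (lev Q) m Q Q₀ (lvl D Q₀) d)| := fun Q hQ =>
    (hgap Q (hGF Q hQ)).resolve_left (Finset.mem_filter.1 hQ).2
  choose! 𝒯 h𝒯 hne h𝒯gap using hgapG
  have h1 := D.sum_boundaryCubes_le hreg hd0.le hi hj hQj F₁ lev fun Q hQ =>
    ⟨hlev Q (Finset.mem_filter.1 hQ).1, (Finset.mem_filter.1 hQ).2⟩
  have h2 := D.sum_le_of_strips hreg hj hQj hd₁0.le le_rfl hε0 hp F₂ lev
    (fun Q hQ => hlev Q (hF₂F Q hQ)) (fun Q hQ => hcube Q (hF₂F Q hQ))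
    (fun Q hQ => (hF Q (hF₂F Q hQ)).2.1) fun Q hQ => (Finset.mem_filter.1 hQ).2
  have h3 := D.sum_le_of_gap hreg hj hQj (hreg.isContent hRK hφ) hd0 (m := m) (N := m + p * 4)
    (by rwa [← hd₁]) hε0.le hκ0 hε hεκ F₃ lev
    (fun Q hQ => hlev Q (hGF Q (hF₃G Q hQ))) (fun Q hQ => hcube Q (hGF Q (hF₃G Q hQ)))
    (fun Q hQ => (hF Q (hGF Q (hF₃G Q hQ))).2.1) 𝒯 (fun Q hQ => h𝒯 Q (hF₃G Q hQ))
    (fun Q hQ => hne Q (hF₃G Q hQ))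
    (fun Q hQ => by
      rw [← hd₁]
      exact not_lt.1 (Finset.mem_filter.1 hQ).2)
    (fun Q hQ => h𝒯gap Q (hF₃G Q hQ))
  rw [← hd₁] at h3
  rw [hsplit, add_mul, add_mul]
  refine add_le_add (add_le_add (h1.trans_eq (by ring)) h2) h3

theorem non_MA_cubes_K_Carleson (n : ℕ) (C a η₀ : ℝ) (hC : 1 < C) (ha : 0 < a)
    (hη₀ : 0 < η₀) (η δ A : ℝ) (hη : 0 < η) (hδ : 0 < δ) (hA : 1 < A) :
    ∃ ζ₀ : ℝ, 0 < ζ₀ ∧ ∀ ζ : ℝ, 0 < ζ → ζ < ζ₀ →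
      ∃ C'' : ℝ, 0 < C'' ∧
        ∀ (X : Type) [MetricSpace X] [CompleteSpace X] [TopologicalSpace.SeparableSpace X]
          [MeasurableSpace X] [BorelSpace X],
        ∀ (μ : Measure X) [IsFiniteMeasure μ],
        ∀ (K : Set X) (RK : ℝ), IsCompact K → 0 < RK →
        (∀ x ∈ K, ∀ r : ℝ, 0 < r → r < RK →
          ENNReal.ofReal (C⁻¹ * r ^ n) ≤ μ (closedBall x r) ∧
            μ (closedBall x r) ≤ ENNReal.ofReal (C * r ^ n)) →
        ∀ (D : CubeSystem X μ K n C RK a η₀) (φ : X → EuclideanSpace ℝ (Fin n)),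
          LipschitzWith 1 φ →
        ∀ Q₀ : Set X, IsCube D Q₀ →
          (∑' Q : ↥({Q | IsCube D Q ∧ Q ⊆ Q₀} \
              (MAset D φ δ ζ A Q₀ ∪ SIset D φ δ Q₀ ∪ LDset D η Q₀)),
            μ ((Q : Set X) ∩ K)) ≤ ENNReal.ofReal C'' * μ Q₀ := by
  refine ⟨1, one_pos, fun ζ hζ _ => ?_⟩
  obtain ⟨m, hm⟩ := pow_unbounded_of_one_lt (32 * A * (C ^ 2 * 256)) (by norm_num : (1 : ℝ) < 16)
  obtain ⟨d, hd⟩ : ∃ d : ℝ, d = 64 * A ^ 2 + 64 * A + 2 := ⟨_, rfl⟩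
  obtain ⟨d₁, hd₁⟩ : ∃ d₁ : ℝ, d₁ = d + 32 * 16 ^ m := ⟨_, rfl⟩
  obtain ⟨κ, hκ⟩ : ∃ κ : ℝ, κ = δ * ζ / (1 + ζ) / 2 := ⟨_, rfl⟩
  have hd0 : 0 < d := by rw [hd]; positivity
  have hd₁0 : 0 < d₁ := by rw [hd₁]; positivity
  have hκ0 : 0 < κ := by rw [hκ]; positivity
  obtain ⟨i, hi⟩ := pow_unbounded_of_one_lt (d + 32) (by norm_num : (1 : ℝ) < 16)
  obtain ⟨q, hq⟩ := pow_unbounded_of_one_lt (2 * d₁ + 32) (by norm_num : (1 : ℝ) < 16)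
  obtain ⟨ε, hε0, hε, hεκ⟩ : ∃ ε : ℝ, 0 < ε ∧ ε * (C ^ 2 * (256 * 16 ^ m) ^ n) ≤ 1 / 2 ∧
      2 * (10 ^ n * C * (ε * (C ^ 2 * (256 * 16 ^ m) ^ n))) ≤ κ / 2 := by
    have hC1 : 0 < C ^ 2 * (256 * (16 : ℝ) ^ m) ^ n := by positivity
    refine ⟨min (1 / 2) (κ / (4 * (10 ^ n * C))) / (C ^ 2 * (256 * 16 ^ m) ^ n), by positivity,
      ?_, ?_⟩ <;> rw [div_mul_cancel₀ _ hC1.ne']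
    · exact min_le_left _ _
    · calc _ ≤ 2 * (10 ^ n * C * (κ / (4 * (10 ^ n * C)))) := by
            gcongr
            exact min_le_right _ _
        _ = κ / 2 := by field_simp; norm_num
  obtain ⟨p, hp⟩ : ∃ p : ℕ, (2 * m + 1 : ℕ) * (C ^ 8 * (16 * (1 + 16) * 256 * 256 *
      (16 * (d₁ + 1 + 32 * 16 ^ m + 16))) ^ n * (1 - (C ^ 2 * 4096 ^ n)⁻¹) ^ p) ≤ ε / 2 := by
    have hpos : 0 < C ^ 2 * (4096 : ℝ) ^ n := by positivity
    have hone : 1 ≤ C ^ 2 * (4096 : ℝ) ^ n :=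
      one_le_mul_of_one_le_of_one_le (one_le_pow₀ hC.le) (one_le_pow₀ (by norm_num))
    have h1 : Tendsto (fun p : ℕ => (2 * m + 1 : ℕ) * (C ^ 8 * (16 * (1 + 16) * 256 * 256 *
        (16 * (d₁ + 1 + 32 * 16 ^ m + 16))) ^ n * (1 - (C ^ 2 * 4096 ^ n)⁻¹) ^ p))
        atTop (𝓝 ((2 * m + 1 : ℕ) * (C ^ 8 * (16 * (1 + 16) * 256 * 256 *
        (16 * (d₁ + 1 + 32 * 16 ^ m + 16))) ^ n * 0))) :=
      ((tendsto_pow_atTop_nhds_zero_of_lt_one (sub_nonneg.2 (inv_le_one_of_one_le₀ hone))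
        (sub_lt_self _ (inv_pos.2 hpos))).const_mul _).const_mul _
    rw [mul_zero, mul_zero] at h1
    exact (h1.eventually_le_const (half_pos hε0)).exists
  refine ⟨_, ?_, fun X _ _ _ _ _ μ _ K RK _ hRK hball D φ hφ Q₀ hQ₀ =>
    tsum_measure_inter_le ?_ fun F hF =>
      D.sum_le_of_notMem (RegularOn.of_ennreal hC hball) hRK hφ hA hδ hζ hQ₀ hd hd₁ hκ hm.le hi.le
        hq.le hε0 hε hεκ hp F fun Q hQ => ?_⟩
  · positivity
  · positivity
  · obtain ⟨⟨h1, h2⟩, h3⟩ := hF Q hQ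
    exact ⟨h1, h2, fun h => h3 (Or.inl (Or.inl h)), fun h => h3 (Or.inl (Or.inr h))⟩

end
end
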